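/- arXiv:2105.12958 — 5 statements merged into one kernel-verified Lean document; each statement's English description precedes it below -/
import Mathlib

section
/- Let W₁, W₂, q₁, q₂ be positive integers with gcd(q₁W₁, q₂W₂) = 1, and let a, b be integers. Then S*_{W₁W₂,b}(q₁q₂, a) = S*_{W₁,b}(q₁, a·\overline{q₂}) · S*_{W₂,b}(q₂, a·\overline{q₁}), where \overline{q₂} denotes a multiplicative inverse of q₂ modulo q₁ and \overline{q₁} a multiplicative inverse of q₁ modulo q₂. -/
open scoped BigOperators

noncomputable section

attribute [local instance] Classical.propDecidable

/-- `e(z) = e^{2πiz}`. -/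
def eC (x : ℝ) : ℂ := Complex.exp (2 * Real.pi * Complex.I * x)

/-- The quadratic form `f(x) = x M xᵀ`. -/
def Qf {s : ℕ} (M : Matrix (Fin s) (Fin s) ℤ) (x : Fin s → ℤ) : ℤ :=
  ∑ i, ∑ j, x i * M i j * x j

/-- The Gauss sum `S*_{W,b}(q,a)`. -/
def SstarG {s : ℕ} (M : Matrix (Fin s) (Fin s) ℤ) (W : ℕ) (b : ℤ) (q : ℕ) (a : ℤ) : ℂ :=
  ∑ c ∈ Fintype.piFinset (fun _ : Fin s => Finset.Icc 1 (q * W)),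
    if ∀ i, Nat.gcd (c i) q = 1 ∧ (c i : ℤ) ≡ b [ZMOD (W : ℤ)] then
      eC (((a * Qf M (fun i => (c i : ℤ))) : ℝ) / (q : ℝ))
    else 0

theorem eC_add (x y : ℝ) : eC (x + y) = eC x * eC y := by
  simp only [eC, ← Complex.exp_add]
  push_cast
  ring_nf

theorem eC_add_intCast (x : ℝ) (k : ℤ) : eC (x + k) = eC x := by
  have hk : eC k = 1 := by
    rw [eC, ← Complex.exp_int_mul_two_pi_mul_I k]
    push_cast
    ring_nf
  rw [eC_add, hk, mul_one]

theorem Qf_modEq {s : ℕ} (M : Matrix (Fin s) (Fin s) ℤ) {n : ℤ} {x y : Fin s → ℤ}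
    (h : ∀ i, x i ≡ y i [ZMOD n]) : Qf M x ≡ Qf M y [ZMOD n] := by
  unfold Qf
  exact Int.ModEq.sum fun i _ => Int.ModEq.sum fun j _ => ((h i).mul_right _).mul (h j)

/-- The representative of the residue class of `c` modulo `N` in `{1, …, N}`. -/
def posMod (N c : ℕ) : ℕ := (c + (N - 1)) % N + 1

theorem posMod_mem {N : ℕ} (hN : 0 < N) (c : ℕ) : posMod N c ∈ Finset.Icc 1 N := by
  have := Nat.mod_lt (c + (N - 1)) hN
  simp only [posMod, Finset.mem_Icc]
  omega

theorem posMod_modEq {N : ℕ} (hN : 0 < N) (c : ℕ) : posMod N c ≡ c [MOD N] := by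
  have h : posMod N c ≡ c + (N - 1) + 1 [MOD N] := (Nat.mod_modEq _ _).add_right 1
  rw [add_assoc, Nat.sub_add_cancel hN] at h
  simpa [Nat.ModEq] using h

theorem eq_of_modEq_of_mem_Icc {N x y : ℕ} (h : x ≡ y [MOD N]) (hx : x ∈ Finset.Icc 1 N)
    (hy : y ∈ Finset.Icc 1 N) : x = y := by
  rw [Finset.mem_Icc] at hx hy
  obtain ⟨x, rfl⟩ := Nat.exists_eq_add_of_le' hx.1
  obtain ⟨y, rfl⟩ := Nat.exists_eq_add_of_le' hy.1
  rw [Nat.ModEq.add_right_cancel' 1 h |>.eq_of_lt_of_lt (by omega) (by omega)]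

theorem sum_piFinset_Icc_mul {ι R : Type*} [Fintype ι] [DecidableEq ι] [NonUnitalNonAssocSemiring R]
    {m n : ℕ} (hm : 0 < m) (hn : 0 < n) (hmn : m.Coprime n) (f g h : (ι → ℕ) → R)
    (hfgh : ∀ c, f c = g (fun i => posMod m (c i)) * h (fun i => posMod n (c i))) :
    ∑ c ∈ Fintype.piFinset (fun _ : ι => Finset.Icc 1 (m * n)), f c =
      (∑ c ∈ Fintype.piFinset (fun _ : ι => Finset.Icc 1 m), g c) *
        ∑ c ∈ Fintype.piFinset (fun _ : ι => Finset.Icc 1 n), h c := by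
  rw [Finset.sum_mul_sum, ← Finset.sum_product']
  refine Finset.sum_nbij (fun c => (fun i => posMod m (c i), fun i => posMod n (c i)))
    ?_ ?_ ?_ fun c _ => hfgh c
  · intro c _
    simp only [Finset.mem_product, Fintype.mem_piFinset]
    exact ⟨fun i => posMod_mem hm _, fun i => posMod_mem hn _⟩
  · intro c hc d hd hcd
    rw [Finset.mem_coe, Fintype.mem_piFinset] at hc hd
    rw [Prod.mk.injEq] at hcd
    funext i
    refine eq_of_modEq_of_mem_Icc ((Nat.modEq_and_modEq_iff_modEq_mul hmn).1 ⟨?_, ?_⟩) (hc i) (hd i)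
    · exact (posMod_modEq hm _).symm.trans ((congrFun hcd.1 i) ▸ posMod_modEq hm _)
    · exact (posMod_modEq hn _).symm.trans ((congrFun hcd.2 i) ▸ posMod_modEq hn _)
  · rintro ⟨x, y⟩ hxy
    simp only [Finset.mem_coe, Finset.mem_product, Fintype.mem_piFinset] at hxy
    have hmn0 := Nat.mul_pos hm hn
    let z := fun i => Nat.chineseRemainder hmn (x i) (y i)
    have hz : ∀ i, posMod (m * n) (z i) ≡ z i [MOD m * n] := fun i => posMod_modEq hmn0 _
    refine ⟨fun i => posMod (m * n) (z i), ?_, ?_⟩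
    · rw [Finset.mem_coe, Fintype.mem_piFinset]
      exact fun i => posMod_mem hmn0 _
    · refine Prod.ext (funext fun i => ?_) (funext fun i => ?_)
      · exact eq_of_modEq_of_mem_Icc ((posMod_modEq hm _).trans
          (((hz i).of_mul_right n).trans (z i).2.1)) (posMod_mem hm _) (hxy.1 i)
      · exact eq_of_modEq_of_mem_Icc ((posMod_modEq hn _).trans
          (((hz i).of_mul_left m).trans (z i).2.2)) (posMod_mem hn _) (hxy.2 i)

theorem eC_div_mul {p q : ℕ} (hp : 0 < p) (hq : 0 < q) (hpq : p.Coprime q) {a u v A B C : ℤ}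
    (hu : (q : ℤ) * u ≡ 1 [ZMOD (p : ℤ)]) (hv : (p : ℤ) * v ≡ 1 [ZMOD (q : ℤ)])
    (hB : A ≡ B [ZMOD p]) (hC : A ≡ C [ZMOD q]) :
    eC ((a * A : ℝ) / ((p * q : ℕ) : ℝ)) =
      eC ((((a * u : ℤ) : ℝ) * B) / p) * eC ((((a * v : ℤ) : ℝ) * C) / q) := by
  have h₁ : (p : ℤ) ∣ A - q * u * B - p * v * C := by
    obtain ⟨k, hk⟩ := hB.dvd
    obtain ⟨l, hl⟩ := hu.dvd
    exact ⟨-k + l * B - v * C, by linear_combination -hk + B * hl⟩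
  have h₂ : (q : ℤ) ∣ A - q * u * B - p * v * C := by
    obtain ⟨k, hk⟩ := hC.dvd
    obtain ⟨l, hl⟩ := hv.dvd
    exact ⟨-k + l * C - u * B, by linear_combination -hk + C * hl⟩
  obtain ⟨k, hk⟩ := (Nat.isCoprime_iff_coprime.2 hpq).mul_dvd h₁ h₂
  rw [← eC_add, ← eC_add_intCast _ (-(a * k))]
  congr 1
  have hk' : (A : ℝ) - q * u * B - p * v * C = p * q * k := by exact_mod_cast hk
  have hp' : (p : ℝ) ≠ 0 := by positivity
  have hq' : (q : ℝ) ≠ 0 := by positivity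
  push_cast
  field_simp
  linear_combination a * hk'

theorem statement4 {s : ℕ} (M : Matrix (Fin s) (Fin s) ℤ) (hsym : M.IsSymm)
    (W₁ W₂ q₁ q₂ : ℕ) (hW₁ : 0 < W₁) (hW₂ : 0 < W₂) (hq₁ : 0 < q₁) (hq₂ : 0 < q₂)
    (hco : Nat.gcd (q₁ * W₁) (q₂ * W₂) = 1) (a b u v : ℤ)
    (hu : (q₂ : ℤ) * u ≡ 1 [ZMOD (q₁ : ℤ)]) (hv : (q₁ : ℤ) * v ≡ 1 [ZMOD (q₂ : ℤ)]) :
    SstarG M (W₁ * W₂) b (q₁ * q₂) a = SstarG M W₁ b q₁ (a * u) * SstarG M W₂ b q₂ (a * v) := by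
  have hco' : Nat.Coprime (q₁ * W₁) (q₂ * W₂) := hco
  have hq : q₁.Coprime q₂ := hco'.coprime_mul_right.coprime_mul_right_right
  have hW : W₁.Coprime W₂ := hco'.coprime_mul_left.coprime_mul_left_right
  have h₁ := Nat.mul_pos hq₁ hW₁
  have h₂ := Nat.mul_pos hq₂ hW₂
  unfold SstarG
  rw [mul_mul_mul_comm q₁ q₂ W₁ W₂]
  refine sum_piFinset_Icc_mul h₁ h₂ hco' _ _ _ fun c => ?_
  have hc₁ := fun i => posMod_modEq h₁ (c i)
  have hc₂ := fun i => posMod_modEq h₂ (c i)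
  have hiff : (∀ i, Nat.gcd (c i) (q₁ * q₂) = 1 ∧ (c i : ℤ) ≡ b [ZMOD ((W₁ * W₂ : ℕ) : ℤ)]) ↔
      (∀ i, Nat.gcd (posMod (q₁ * W₁) (c i)) q₁ = 1 ∧
        (posMod (q₁ * W₁) (c i) : ℤ) ≡ b [ZMOD (W₁ : ℤ)]) ∧
      (∀ i, Nat.gcd (posMod (q₂ * W₂) (c i)) q₂ = 1 ∧
        (posMod (q₂ * W₂) (c i) : ℤ) ≡ b [ZMOD (W₂ : ℤ)]) := by
    rw [← forall_and]
    refine forall_congr' fun i => ?_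
    have e₁ := Int.natCast_modEq_iff.2 ((hc₁ i).of_mul_left q₁)
    have e₂ := Int.natCast_modEq_iff.2 ((hc₂ i).of_mul_left q₂)
    have hmod : (c i : ℤ) ≡ b [ZMOD ((W₁ * W₂ : ℕ) : ℤ)] ↔
        (c i : ℤ) ≡ b [ZMOD (W₁ : ℤ)] ∧ (c i : ℤ) ≡ b [ZMOD (W₂ : ℤ)] := by
      rw [Nat.cast_mul, Int.modEq_and_modEq_iff_modEq_mul (by simpa using hW)]
    rw [((hc₁ i).of_mul_right W₁).gcd_eq, ((hc₂ i).of_mul_right W₂).gcd_eq, hmod,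
      ← Nat.coprime_iff_gcd_eq_one, ← Nat.coprime_iff_gcd_eq_one, ← Nat.coprime_iff_gcd_eq_one,
      Nat.coprime_mul_iff_right]
    have m₁ : (posMod (q₁ * W₁) (c i) : ℤ) ≡ b [ZMOD (W₁ : ℤ)] ↔ (c i : ℤ) ≡ b [ZMOD (W₁ : ℤ)] :=
      ⟨e₁.symm.trans, e₁.trans⟩
    have m₂ : (posMod (q₂ * W₂) (c i) : ℤ) ≡ b [ZMOD (W₂ : ℤ)] ↔ (c i : ℤ) ≡ b [ZMOD (W₂ : ℤ)] :=
      ⟨e₂.symm.trans, e₂.trans⟩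
    rw [m₁, m₂]
    tauto
  rw [ite_zero_mul_ite_zero]
  refine if_congr hiff ?_ rfl
  exact eC_div_mul hq₁ hq₂ hq hu hv
    (Qf_modEq M fun i => Int.natCast_modEq_iff.2 ((hc₁ i).symm.of_mul_right W₁))
    (Qf_modEq M fun i => Int.natCast_modEq_iff.2 ((hc₂ i).symm.of_mul_right W₂))
end
end

section
/- Let W₁, W₂, q₁, q₂ be positive integers with gcd(q₁W₁, q₂W₂) = 1 and let b be an integer. Then B*_{W₁W₂,b}(q₁q₂) = B*_{W₁,b}(q₁) · B*_{W₂,b}(q₂). -/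
open scoped BigOperators

noncomputable section

attribute [local instance] Classical.propDecidable

/-- The complete sum `S(q,a)`. -/
def SfullG {s : ℕ} (M : Matrix (Fin s) (Fin s) ℤ) (q : ℕ) (a : ℤ) : ℂ :=
  ∑ c ∈ Fintype.piFinset (fun _ : Fin s => Finset.Icc 1 q),
    eC (((a * Qf M (fun i => (c i : ℤ))) : ℝ) / (q : ℝ))

/-- `B*_{W,b}(q) = φ(qW)^{-s} ∑_{1 ≤ a ≤ q, (a,q)=1} S*_{W,b}(q,a)`. -/
def BstarG {s : ℕ} (M : Matrix (Fin s) (Fin s) ℤ) (W : ℕ) (b : ℤ) (q : ℕ) : ℂ :=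
  ((Nat.totient (q * W) : ℂ) ^ s)⁻¹ *
    ∑ a ∈ Finset.Icc 1 q, if Nat.gcd a q = 1 then SstarG M W b q (a : ℤ) else 0

/-- `B(q) = q^{-s} ∑_{1 ≤ a ≤ q, (a,q)=1} S(q,a)`. -/
def BfullG {s : ℕ} (M : Matrix (Fin s) (Fin s) ℤ) (q : ℕ) : ℂ :=
  ((q : ℂ) ^ s)⁻¹ *
    ∑ a ∈ Finset.Icc 1 q, if Nat.gcd a q = 1 then SfullG M q (a : ℤ) else 0

/-- `f` is translation invariant, i.e. `1 · M = 0`. -/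
def TransInv {s : ℕ} (M : Matrix (Fin s) (Fin s) ℤ) : Prop :=
  ∀ j, ∑ i, M i j = 0

/-- The off-diagonal rank of `M` is at least `n`. -/
def RankOffGe {s : ℕ} (M : Matrix (Fin s) (Fin s) ℤ) (n : ℕ) : Prop :=
  ∃ (r : ℕ) (ι κ : Fin r → Fin s), Function.Injective ι ∧ Function.Injective κ ∧
    (∀ k l, ι k ≠ κ l) ∧ n ≤ (Matrix.of fun k l => (M (ι k) (κ l) : ℚ)).rank

/-- The quadratic form of an integer matrix, evaluated over a commutative ring. -/
def ringQf {s : ℕ} (R : Type*) [CommRing R] (M : Matrix (Fin s) (Fin s) ℤ) (x : Fin s → R) : R :=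
  ∑ i, ∑ j, x i * (M i j : R) * x j

theorem map_ringQf {s : ℕ} {R S : Type*} [CommRing R] [CommRing S] (g : R →+* S)
    (M : Matrix (Fin s) (Fin s) ℤ) (x : Fin s → R) :
    g (ringQf R M x) = ringQf S M (fun i => g (x i)) := by
  simp [ringQf, map_sum]

theorem intCast_Qf {s : ℕ} {R : Type*} [CommRing R] (M : Matrix (Fin s) (Fin s) ℤ)
    (x : Fin s → ℤ) : ((Qf M x : ℤ) : R) = ringQf R M (fun i => (x i : R)) := by
  simp [Qf, ringQf]

/-- The condition on the coordinates in the Gauss sum, read off modulo `q * W`. -/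
def IsAdmissible (W : ℕ) (b : ℤ) (q : ℕ) (x : ZMod (q * W)) : Prop :=
  IsUnit (ZMod.castHom (dvd_mul_right q W) (ZMod q) x) ∧
    ZMod.castHom (dvd_mul_left W q) (ZMod W) x = (b : ZMod W)

/-- The Gauss sum as a sum over residue classes. -/
def zmodSstar {s : ℕ} (M : Matrix (Fin s) (Fin s) ℤ) (W : ℕ) (b : ℤ) (q : ℕ)
    [NeZero q] [NeZero (q * W)] (a : ZMod q) : ℂ :=
  ∑ x : Fin s → ZMod (q * W),
    if ∀ i, IsAdmissible W b q (x i) then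
      ZMod.stdAddChar
        (a * ringQf (ZMod q) M (fun i => ZMod.castHom (dvd_mul_right q W) (ZMod q) (x i)))
    else 0

theorem bijOn_natCast_Icc (n : ℕ) [NeZero n] :
    Set.BijOn (fun c : ℕ => (c : ZMod n)) (Finset.Icc 1 n) Set.univ := by
  have hn : 0 < n := NeZero.pos n
  refine ⟨fun _ _ => Set.mem_univ _, fun x hx y hy h => ?_, fun z _ => ?_⟩
  · simp only [Finset.coe_Icc, Set.mem_Icc] at hx hy
    have h' : ((x - 1 : ℕ) : ZMod n) = ((y - 1 : ℕ) : ZMod n) := by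
      rw [Nat.cast_sub hx.1, Nat.cast_sub hy.1]
      exact congrArg (· - _) h
    rw [ZMod.natCast_eq_natCast_iff', Nat.mod_eq_of_lt (by lia), Nat.mod_eq_of_lt (by lia)] at h'
    lia
  · refine ⟨(z - 1).val + 1, ?_, ?_⟩
    · have := ZMod.val_lt (z - 1)
      simp only [Finset.coe_Icc, Set.mem_Icc]
      lia
    · simp

theorem sum_Icc_natCast (n : ℕ) [NeZero n] (F : ZMod n → ℂ) :
    ∑ c ∈ Finset.Icc 1 n, F (c : ZMod n) = ∑ x, F x := by
  have h := bijOn_natCast_Icc n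
  exact Finset.sum_nbij (fun c : ℕ => (c : ZMod n)) (fun _ _ => Finset.mem_univ _) h.injOn
    (by simpa using h.surjOn) (fun _ _ => rfl)

theorem sum_piFinset_Icc_natCast {s : ℕ} (n : ℕ) [NeZero n] (F : (Fin s → ZMod n) → ℂ) :
    ∑ c ∈ Fintype.piFinset (fun _ : Fin s => Finset.Icc 1 n), F (fun i => (c i : ZMod n)) =
      ∑ x, F x := by
  have h := bijOn_natCast_Icc n
  refine Finset.sum_nbij (fun c i => (c i : ZMod n)) (fun _ _ => Finset.mem_univ _)
    (fun x hx y hy hxy => ?_) (fun z _ => ?_) (fun _ _ => rfl)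
  · rw [Finset.mem_coe, Fintype.mem_piFinset] at hx hy
    exact funext fun i => h.injOn (hx i) (hy i) (congrFun hxy i)
  · choose c hc hcz using fun i => h.surjOn (Set.mem_univ (z i))
    exact ⟨c, Fintype.mem_piFinset.2 hc, funext hcz⟩

theorem eC_div_eq_stdAddChar (q : ℕ) [NeZero q] (k : ℤ) :
    eC ((k : ℝ) / (q : ℝ)) = ZMod.stdAddChar (k : ZMod q) := by
  rw [ZMod.stdAddChar_coe, eC]
  congr 1
  push_cast
  ring

theorem SstarG_eq_zmodSstar {s : ℕ} (M : Matrix (Fin s) (Fin s) ℤ) (W : ℕ) (b : ℤ) (q : ℕ)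
    [NeZero q] [NeZero (q * W)] (a : ℤ) :
    SstarG M W b q a = zmodSstar M W b q (a : ZMod q) := by
  rw [SstarG, zmodSstar, ← sum_piFinset_Icc_natCast]
  refine Finset.sum_congr rfl fun c _ => ?_
  refine if_congr (forall_congr' fun i => ?_) ?_ rfl
  · rw [IsAdmissible, map_natCast, map_natCast, ZMod.isUnit_iff_coprime,
      ← ZMod.intCast_eq_intCast_iff, Int.cast_natCast, Nat.Coprime]
  · have h := eC_div_eq_stdAddChar q (a * Qf M (fun i => (c i : ℤ)))
    rw [Int.cast_mul, Int.cast_mul, intCast_Qf (R := ZMod q)] at h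
    simpa using h

theorem BstarG_eq {s : ℕ} (M : Matrix (Fin s) (Fin s) ℤ) (W : ℕ) (b : ℤ) (q : ℕ)
    [NeZero q] [NeZero (q * W)] :
    BstarG M W b q = ((Nat.totient (q * W) : ℂ) ^ s)⁻¹ *
      ∑ a : ZMod q, if IsUnit a then zmodSstar M W b q a else 0 := by
  rw [BstarG, ← sum_Icc_natCast]
  congr 1
  refine Finset.sum_congr rfl fun a _ => if_congr ?_ ?_ rfl
  · rw [ZMod.isUnit_iff_coprime, Nat.Coprime]
  · rw [SstarG_eq_zmodSstar, Int.cast_natCast]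

theorem ringHom_zmod_congr {n : ℕ} {R : Type*} [Ring R] (f g : ZMod n →+* R) (x : ZMod n) :
    f x = g x :=
  RingHom.congr_fun (RingHom.ext_zmod f g) x

/-- The Chinese remainder isomorphism for a modulus presented as a product of coprime numbers. -/
def crtEquiv {N m n : ℕ} (hN : N = m * n) (h : m.Coprime n) : ZMod N ≃+* ZMod m × ZMod n :=
  (ZMod.ringEquivCongr hN).trans (ZMod.chineseRemainder h)

theorem stdAddChar_mul_of_coprime {m n : ℕ} [NeZero m] [NeZero n] [NeZero (m * n)]
    (h : m.Coprime n) (z : ZMod (m * n)) (x : ZMod m) (y : ZMod n)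
    (hz : crtEquiv rfl h z = (n * x, m * y)) :
    ZMod.stdAddChar z = ZMod.stdAddChar x * ZMod.stdAddChar y := by
  obtain ⟨k, rfl⟩ := ZMod.intCast_surjective x
  obtain ⟨l, rfl⟩ := ZMod.intCast_surjective y
  have hz' : z = ((n * k + m * l : ℤ) : ZMod (m * n)) := by
    apply (crtEquiv rfl h).injective
    rw [hz, map_intCast]
    ext <;> simp
  have hm : (m : ℂ) ≠ 0 := NeZero.ne _
  have hn : (n : ℂ) ≠ 0 := NeZero.ne _
  rw [hz', ZMod.stdAddChar_coe, ZMod.stdAddChar_coe, ZMod.stdAddChar_coe, ← Complex.exp_add]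
  congr 1
  push_cast
  field_simp

theorem isAdmissible_mul {W₁ W₂ q₁ q₂ : ℕ} (b : ℤ)
    (hN : q₁ * q₂ * (W₁ * W₂) = (q₁ * W₁) * (q₂ * W₂))
    (hco : (q₁ * W₁).Coprime (q₂ * W₂)) (x : ZMod (q₁ * q₂ * (W₁ * W₂))) :
    IsAdmissible (W₁ * W₂) b (q₁ * q₂) x ↔
      IsAdmissible W₁ b q₁ (crtEquiv hN hco x).1 ∧
        IsAdmissible W₂ b q₂ (crtEquiv hN hco x).2 := by
  have hq : q₁.Coprime q₂ := hco.coprime_mul_right.coprime_mul_right_right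
  have hW : W₁.Coprime W₂ := hco.coprime_mul_left.coprime_mul_left_right
  obtain ⟨k, rfl⟩ := ZMod.intCast_surjective x
  simp only [IsAdmissible, map_intCast, Prod.fst_intCast, Prod.snd_intCast]
  rw [← MulEquiv.isUnit_map (crtEquiv rfl hq), ← (crtEquiv rfl hW).injective.eq_iff]
  simp only [map_intCast, Prod.isUnit_iff, Prod.ext_iff, Prod.fst_intCast, Prod.snd_intCast]
  tauto

theorem zmodSstar_mul {s : ℕ} (M : Matrix (Fin s) (Fin s) ℤ) {W₁ W₂ q₁ q₂ : ℕ} (b : ℤ)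
    [NeZero q₁] [NeZero q₂] [NeZero (q₁ * W₁)] [NeZero (q₂ * W₂)]
    [NeZero (q₁ * q₂)] [NeZero (q₁ * q₂ * (W₁ * W₂))]
    (hco : (q₁ * W₁).Coprime (q₂ * W₂)) (hq : q₁.Coprime q₂)
    (a : ZMod (q₁ * q₂)) (a₁ : ZMod q₁) (a₂ : ZMod q₂)
    (ha : crtEquiv rfl hq a = (q₂ * a₁, q₁ * a₂)) :
    zmodSstar M (W₁ * W₂) b (q₁ * q₂) a = zmodSstar M W₁ b q₁ a₁ * zmodSstar M W₂ b q₂ a₂ := by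
  have hN : q₁ * q₂ * (W₁ * W₂) = (q₁ * W₁) * (q₂ * W₂) := by ring
  rw [zmodSstar, zmodSstar, zmodSstar, Fintype.sum_mul_sum, ← Fintype.sum_prod_type']
  refine Fintype.sum_equiv
    ((Equiv.piCongrRight fun _ => (crtEquiv hN hco).toEquiv).trans
      (Equiv.arrowProdEquivProdArrow _ _ _)) _ _ fun x => ?_
  rw [ite_zero_mul_ite_zero]
  refine if_congr ?_ ?_ rfl
  · simp only [isAdmissible_mul b hN hco, forall_and]
    rfl
  · apply stdAddChar_mul_of_coprime hq
    rw [map_mul, ha]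
    have h₁ := map_ringQf ((RingHom.fst _ _).comp (crtEquiv rfl hq).toRingHom) M
      (fun i => ZMod.castHom (dvd_mul_right (q₁ * q₂) (W₁ * W₂)) (ZMod (q₁ * q₂)) (x i))
    have h₂ := map_ringQf ((RingHom.snd _ _).comp (crtEquiv rfl hq).toRingHom) M
      (fun i => ZMod.castHom (dvd_mul_right (q₁ * q₂) (W₁ * W₂)) (ZMod (q₁ * q₂)) (x i))
    ext
    · refine (congrArg (_ * ·) (h₁.trans ?_)).trans (mul_assoc _ _ _)
      congr 1
      funext i
      exact ringHom_zmod_congr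
        (((RingHom.fst _ _).comp (crtEquiv rfl hq).toRingHom).comp (ZMod.castHom _ _))
        ((ZMod.castHom (dvd_mul_right q₁ W₁) _).comp
          ((RingHom.fst _ _).comp (crtEquiv hN hco).toRingHom)) (x i)
    · refine (congrArg (_ * ·) (h₂.trans ?_)).trans (mul_assoc _ _ _)
      congr 1
      funext i
      exact ringHom_zmod_congr
        (((RingHom.snd _ _).comp (crtEquiv rfl hq).toRingHom).comp (ZMod.castHom _ _))
        ((ZMod.castHom (dvd_mul_right q₂ W₂) _).comp
          ((RingHom.snd _ _).comp (crtEquiv hN hco).toRingHom)) (x i)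

theorem statement7 {s : ℕ} (M : Matrix (Fin s) (Fin s) ℤ) (hsym : M.IsSymm)
    (W₁ W₂ q₁ q₂ : ℕ) (hW₁ : 0 < W₁) (hW₂ : 0 < W₂) (hq₁ : 0 < q₁) (hq₂ : 0 < q₂)
    (hco : Nat.gcd (q₁ * W₁) (q₂ * W₂) = 1) (b : ℤ) :
    BstarG M (W₁ * W₂) b (q₁ * q₂) = BstarG M W₁ b q₁ * BstarG M W₂ b q₂ := by
  have : NeZero q₁ := ⟨hq₁.ne'⟩
  have : NeZero q₂ := ⟨hq₂.ne'⟩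
  have : NeZero W₁ := ⟨hW₁.ne'⟩
  have : NeZero W₂ := ⟨hW₂.ne'⟩
  have hco' : (q₁ * W₁).Coprime (q₂ * W₂) := hco
  have hq : q₁.Coprime q₂ := hco'.coprime_mul_right.coprime_mul_right_right
  have hN : q₁ * q₂ * (W₁ * W₂) = (q₁ * W₁) * (q₂ * W₂) := by ring
  have hu₁ : IsUnit (q₂ : ZMod q₁) := (ZMod.isUnit_iff_coprime _ _).2 hq.symm
  have hu₂ : IsUnit (q₁ : ZMod q₂) := (ZMod.isUnit_iff_coprime _ _).2 hq
  have hsum : ∑ a : ZMod (q₁ * q₂),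
        (if IsUnit a then zmodSstar M (W₁ * W₂) b (q₁ * q₂) a else 0) =
      (∑ a : ZMod q₁, if IsUnit a then zmodSstar M W₁ b q₁ a else 0) *
        ∑ a : ZMod q₂, if IsUnit a then zmodSstar M W₂ b q₂ a else 0 := by
    rw [Fintype.sum_mul_sum, ← Fintype.sum_prod_type']
    symm
    refine Fintype.sum_equiv ((Equiv.prodCongr hu₁.unit.mulLeft hu₂.unit.mulLeft).trans
      (crtEquiv rfl hq).symm.toEquiv) _ _ fun p => ?_
    have ha : crtEquiv rfl hq (((Equiv.prodCongr hu₁.unit.mulLeft hu₂.unit.mulLeft).trans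
        (crtEquiv rfl hq).symm.toEquiv) p) = (q₂ * p.1, q₁ * p.2) :=
      (crtEquiv rfl hq).apply_symm_apply _
    rw [ite_zero_mul_ite_zero]
    refine if_congr ?_ (zmodSstar_mul M b hco' hq _ _ _ ha).symm rfl
    rw [← MulEquiv.isUnit_map (crtEquiv rfl hq), ha, Prod.isUnit_iff]
    simp [IsUnit.mul_iff, hu₁, hu₂]
  rw [BstarG_eq, BstarG_eq, BstarG_eq, hsum, hN, Nat.totient_mul hco', Nat.cast_mul, mul_pow,
    mul_inv]
  ring
end
end

section
/- Let W₁, W₂, q₁, q₂ be positive integers with gcd(q₁W₁, q₂W₂) = 1, and let a, b, h be integers. Then R*_{W₁W₂,b}(q₁q₂, a, h) = R*_{W₁,b}(q₁, a·\overline{q₂W₂}, h) · R*_{W₂,b}(q₂, a·\overline{q₁W₁}, h), where \overline{q₂W₂} denotes a multiplicative inverse of q₂W₂ modulo q₁W₁ and \overline{q₁W₁} a multiplicative inverse of q₁W₁ modulo q₂W₂. -/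
open scoped BigOperators

noncomputable section

attribute [local instance] Classical.propDecidable

/-- `R*_{W,b}(q,a,h) = ∑_{1≤c≤qW, (c,q)=1, c≡b (mod W)} e(ach/(qW))`. -/
def RstarG (W : ℕ) (b : ℤ) (q : ℕ) (a h : ℤ) : ℂ :=
  ∑ c ∈ Finset.Icc 1 (q * W),
    if Nat.gcd c q = 1 ∧ (c : ℤ) ≡ b [ZMOD (W : ℤ)] then
      eC (((a * c * h : ℤ) : ℝ) / ((q * W : ℕ) : ℝ))
    else 0

/-- The summand of `RstarG` at `c`. -/
def RstarTerm (W : ℕ) (b : ℤ) (q : ℕ) (a h : ℤ) (c : ℕ) : ℂ :=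
  if Nat.gcd c q = 1 ∧ (c : ℤ) ≡ b [ZMOD (W : ℤ)] then
    eC (((a * c * h : ℤ) : ℝ) / ((q * W : ℕ) : ℝ))
  else 0

theorem eC_intCast (n : ℤ) : eC n = 1 := by
  unfold eC
  rw [Complex.exp_eq_one_iff]
  exact ⟨n, by push_cast; ring⟩

theorem eC_div_congr {N : ℕ} (hN : 0 < N) {m n : ℤ} (hmn : m ≡ n [ZMOD (N : ℤ)]) :
    eC ((m : ℝ) / (N : ℝ)) = eC ((n : ℝ) / (N : ℝ)) := by
  obtain ⟨k, hk⟩ := hmn.symm.dvd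
  have hN' : (N : ℝ) ≠ 0 := by positivity
  have hm : (m : ℝ) / N = n / N + (k : ℤ) := by
    have : (m : ℝ) = n + N * k := by
      have : m = n + N * k := by linarith
      exact_mod_cast this
    rw [this]
    field_simp
  rw [hm, eC_add, eC_intCast, mul_one]

theorem RstarTerm_congr {W q : ℕ} (hW : 0 < W) (hq : 0 < q) (b a h : ℤ) {c d : ℕ}
    (hcd : c ≡ d [MOD q * W]) : RstarTerm W b q a h c = RstarTerm W b q a h d := by
  have hgcd : Nat.gcd c q = Nat.gcd d q := (Nat.ModEq.of_mul_right W hcd).gcd_eq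
  have hmod : (c : ℤ) ≡ d [ZMOD (W : ℤ)] :=
    Int.natCast_modEq_iff.mpr (Nat.ModEq.of_mul_left q hcd)
  have hmod' : (c : ℤ) ≡ b [ZMOD (W : ℤ)] ↔ (d : ℤ) ≡ b [ZMOD (W : ℤ)] :=
    ⟨hmod.symm.trans, hmod.trans⟩
  have he : eC (((a * c * h : ℤ) : ℝ) / ((q * W : ℕ) : ℝ)) =
      eC (((a * d * h : ℤ) : ℝ) / ((q * W : ℕ) : ℝ)) :=
    eC_div_congr (Nat.mul_pos hq hW)
      (((Int.natCast_modEq_iff.mpr hcd).mul_left a).mul_right h)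
  unfold RstarTerm
  simp only [hgcd, hmod', he]

theorem RstarG_eq_sum_range {W q : ℕ} (hW : 0 < W) (hq : 0 < q) (b a h : ℤ) :
    RstarG W b q a h = ∑ c ∈ Finset.range (q * W), RstarTerm W b q a h c := by
  have hper : RstarTerm W b q a h (q * W) = RstarTerm W b q a h 0 :=
    RstarTerm_congr hW hq b a h (by simp [Nat.ModEq])
  have hIcc : RstarG W b q a h =
      ∑ c ∈ Finset.range (q * W), RstarTerm W b q a h (c + 1) := by
    change ∑ c ∈ Finset.Icc 1 (q * W), RstarTerm W b q a h c = _
    rw [Finset.range_eq_Ico, Finset.sum_Ico_add' (RstarTerm W b q a h) 0 (q * W) 1]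
    rfl
  have hsucc := Finset.sum_range_succ' (RstarTerm W b q a h) (q * W)
  rw [Finset.sum_range_succ, hper] at hsucc
  rw [hIcc]
  exact (add_right_cancel hsucc).symm

theorem RstarTerm_mul {W₁ W₂ q₁ q₂ : ℕ} (hW₁ : 0 < W₁) (hW₂ : 0 < W₂)
    (hq₁ : 0 < q₁) (hq₂ : 0 < q₂) (hco : Nat.Coprime (q₁ * W₁) (q₂ * W₂))
    (a b h u v : ℤ)
    (hu : ((q₂ * W₂ : ℕ) : ℤ) * u ≡ 1 [ZMOD ((q₁ * W₁ : ℕ) : ℤ)])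
    (hv : ((q₁ * W₁ : ℕ) : ℤ) * v ≡ 1 [ZMOD ((q₂ * W₂ : ℕ) : ℤ)]) (c : ℕ) :
    RstarTerm (W₁ * W₂) b (q₁ * q₂) a h c =
      RstarTerm W₁ b q₁ (a * u) h c * RstarTerm W₂ b q₂ (a * v) h c := by
  have hW : Nat.Coprime W₁ W₂ := hco.coprime_mul_left.coprime_mul_left_right
  have hmod : (c : ℤ) ≡ b [ZMOD ((W₁ * W₂ : ℕ) : ℤ)] ↔
      (c : ℤ) ≡ b [ZMOD (W₁ : ℤ)] ∧ (c : ℤ) ≡ b [ZMOD (W₂ : ℤ)] := by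
    push_cast
    exact (Int.modEq_and_modEq_iff_modEq_mul (by simpa using hW)).symm
  have hgcd : Nat.gcd c (q₁ * q₂) = 1 ↔ Nat.gcd c q₁ = 1 ∧ Nat.gcd c q₂ = 1 :=
    Nat.coprime_mul_iff_right
  have hone : (1 : ℤ) ≡ ((q₂ * W₂ : ℕ) : ℤ) * u + ((q₁ * W₁ : ℕ) : ℤ) * v
      [ZMOD ((q₁ * W₁ : ℕ) : ℤ) * ((q₂ * W₂ : ℕ) : ℤ)] := by
    refine (Int.modEq_and_modEq_iff_modEq_mul (by rwa [Int.natAbs_natCast, Int.natAbs_natCast])).mp ⟨?_, ?_⟩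
    · exact (hu.add (Int.modEq_zero_iff_dvd.mpr (dvd_mul_right _ v))).symm
    · exact ((Int.modEq_zero_iff_dvd.mpr (dvd_mul_right _ u)).add hv).symm
  have he : eC (((a * c * h : ℤ) : ℝ) / ((q₁ * q₂ * (W₁ * W₂) : ℕ) : ℝ)) =
      eC (((a * u * c * h : ℤ) : ℝ) / ((q₁ * W₁ : ℕ) : ℝ)) *
        eC (((a * v * c * h : ℤ) : ℝ) / ((q₂ * W₂ : ℕ) : ℝ)) := by
    have hN : ((q₁ * W₁ : ℕ) : ℤ) * ((q₂ * W₂ : ℕ) : ℤ) =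
        ((q₁ * q₂ * (W₁ * W₂) : ℕ) : ℤ) := by
      push_cast
      ring
    rw [hN] at hone
    have hmul := hone.mul_left (a * c * h)
    rw [mul_one] at hmul
    rw [eC_div_congr (by positivity) hmul, ← eC_add]
    congr 1
    push_cast
    field_simp
  unfold RstarTerm
  by_cases h₁ : Nat.gcd c q₁ = 1 ∧ (c : ℤ) ≡ b [ZMOD (W₁ : ℤ)]
  · by_cases h₂ : Nat.gcd c q₂ = 1 ∧ (c : ℤ) ≡ b [ZMOD (W₂ : ℤ)]
    · rw [if_pos h₁, if_pos h₂,
        if_pos ⟨hgcd.mpr ⟨h₁.1, h₂.1⟩, hmod.mpr ⟨h₁.2, h₂.2⟩⟩, he]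
    · rw [if_neg h₂, mul_zero,
        if_neg fun H => h₂ ⟨(hgcd.mp H.1).2, (hmod.mp H.2).2⟩]
  · rw [if_neg h₁, zero_mul,
      if_neg fun H => h₁ ⟨(hgcd.mp H.1).1, (hmod.mp H.2).1⟩]

theorem sum_range_mul_of_coprime {M N : ℕ} (hM : 0 < M) (hN : 0 < N)
    (hco : Nat.Coprime M N) (f g : ℕ → ℂ) :
    ∑ c ∈ Finset.range (M * N), f (c % M) * g (c % N) =
      (∑ c ∈ Finset.range M, f c) * ∑ c ∈ Finset.range N, g c := by
  rw [Finset.sum_mul_sum, ← Finset.sum_product']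
  refine Finset.sum_nbij' (fun c => (c % M, c % N))
    (fun p => (Nat.chineseRemainder hco p.1 p.2 : ℕ)) ?_ ?_ ?_ ?_ ?_
  · intro c _
    simp [Nat.mod_lt, hM, hN]
  · intro p _
    exact Finset.mem_range.mpr (Nat.chineseRemainder_lt_mul hco _ _ hM.ne' hN.ne')
  · intro c hc
    have hz := (Nat.chineseRemainder hco (c % M) (c % N)).2
    have hmod : (Nat.chineseRemainder hco (c % M) (c % N) : ℕ) ≡ c [MOD M * N] :=
      (Nat.modEq_and_modEq_iff_modEq_mul hco).mp
        ⟨hz.1.trans (Nat.mod_modEq c M), hz.2.trans (Nat.mod_modEq c N)⟩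
    exact hmod.eq_of_lt_of_lt (Nat.chineseRemainder_lt_mul hco _ _ hM.ne' hN.ne')
      (Finset.mem_range.mp hc)
  · rintro ⟨x, y⟩ hp
    have hz := (Nat.chineseRemainder hco x y).2
    simp only [Finset.mem_product, Finset.mem_range] at hp
    exact Prod.ext (Eq.trans hz.1 (Nat.mod_eq_of_lt hp.1)) (Eq.trans hz.2 (Nat.mod_eq_of_lt hp.2))
  · intro c _
    rfl

theorem statement11 (W₁ W₂ q₁ q₂ : ℕ) (hW₁ : 0 < W₁) (hW₂ : 0 < W₂)
    (hq₁ : 0 < q₁) (hq₂ : 0 < q₂) (hco : Nat.gcd (q₁ * W₁) (q₂ * W₂) = 1)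
    (a b h u v : ℤ)
    (hu : ((q₂ * W₂ : ℕ) : ℤ) * u ≡ 1 [ZMOD ((q₁ * W₁ : ℕ) : ℤ)])
    (hv : ((q₁ * W₁ : ℕ) : ℤ) * v ≡ 1 [ZMOD ((q₂ * W₂ : ℕ) : ℤ)]) :
    RstarG (W₁ * W₂) b (q₁ * q₂) a h =
      RstarG W₁ b q₁ (a * u) h * RstarG W₂ b q₂ (a * v) h := by
  rw [RstarG_eq_sum_range (Nat.mul_pos hW₁ hW₂) (Nat.mul_pos hq₁ hq₂),
    RstarG_eq_sum_range hW₁ hq₁, RstarG_eq_sum_range hW₂ hq₂,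
    ← sum_range_mul_of_coprime (Nat.mul_pos hq₁ hW₁) (Nat.mul_pos hq₂ hW₂) hco,
    mul_mul_mul_comm q₁ q₂ W₁ W₂]
  refine Finset.sum_congr rfl fun c _ => ?_
  rw [RstarTerm_mul hW₁ hW₂ hq₁ hq₂ hco a b h u v hu hv,
    RstarTerm_congr hW₁ hq₁ b (a * u) h (Nat.mod_modEq c (q₁ * W₁)),
    RstarTerm_congr hW₂ hq₂ b (a * v) h (Nat.mod_modEq c (q₂ * W₂))]
end
end

section
/- There is an absolute constant C such that the following holds for all sufficiently large X. Let X/2 ≤ Y₀ < Y₀+Y ≤ X with Y > X/log X, set I = (Y₀, Y₀+Y], let b, W be integers with 0 ≤ b < W ≤ log X and gcd(b,W) = 1, and let v be a nonzero integer. Then the number of pairs (p₁, p₂) of primes with p₁, p₂ ∈ I, p₁ ≡ p₂ ≡ b (mod W) and p₁ − p₂ = Wv is at most C · (Y/(φ(W)(log X)²)) · ρ(Wv). -/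
open scoped BigOperators

noncomputable section

attribute [local instance] Classical.propDecidable

/-- `ρ(v) = ∏_{p ∣ v} (1 + 1/p)`, the product over primes dividing the nonzero integer `v`. -/
def rhoZ (v : ℤ) : ℝ := ∏ p ∈ v.natAbs.primeFactors, (1 + 1 / (p : ℝ))

/-- The number of pairs of primes `p₁, p₂ ∈ I = (Y₀, Y₀+Y]` with
`p₁ ≡ p₂ ≡ b (mod W)` and `p₁ - p₂ = W v`; all such primes are at most `N`. -/
def TwinCount (b W : ℕ) (Y0 Y : ℝ) (v : ℤ) (N : ℕ) : ℕ :=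
  ((Finset.Icc 1 N ×ˢ Finset.Icc 1 N).filter fun p =>
    Nat.Prime p.1 ∧ Nat.Prime p.2 ∧
    Y0 < (p.1 : ℝ) ∧ (p.1 : ℝ) ≤ Y0 + Y ∧ Y0 < (p.2 : ℝ) ∧ (p.2 : ℝ) ≤ Y0 + Y ∧
    p.1 ≡ b [MOD W] ∧ p.2 ≡ b [MOD W] ∧ (p.1 : ℤ) - (p.2 : ℤ) = (W : ℤ) * v).card

section

open Finset ArithmeticFunction
open scoped ArithmeticFunction.Moebius

theorem sum_moebius_between {l k : ℕ} (hk : Squarefree k) (hlk : l ∣ k) :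
    ∑ d ∈ k.divisors with l ∣ d, μ d = if k = l then μ l else 0 := by
  obtain ⟨m, rfl⟩ := hlk
  have hl0 : l ≠ 0 := by rintro rfl; simp at hk
  have hm0 : m ≠ 0 := by rintro rfl; simp at hk
  have himg : ((l * m).divisors.filter (l ∣ ·)) = m.divisors.image (l * ·) := by
    ext d
    simp only [mem_filter, Nat.mem_divisors, mem_image]
    constructor
    · rintro ⟨⟨h1, h2⟩, e, rfl⟩
      exact ⟨e, ⟨Nat.dvd_of_mul_dvd_mul_left (Nat.pos_of_ne_zero hl0) h1, hm0⟩, rfl⟩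
    · rintro ⟨e, ⟨h1, h2⟩, rfl⟩
      exact ⟨⟨Nat.mul_dvd_mul_left l h1, mul_ne_zero hl0 hm0⟩, dvd_mul_right _ _⟩
  rw [himg, sum_image (fun a _ b _ h => Nat.eq_of_mul_eq_mul_left (Nat.pos_of_ne_zero hl0) h)]
  have hcop : ∀ e ∈ m.divisors, μ (l * e) = μ l * μ e := fun e he =>
    isMultiplicative_moebius.map_mul_of_coprime
      ((Nat.coprime_of_squarefree_mul hk).coprime_dvd_right (Nat.dvd_of_mem_divisors he))
  rw [sum_congr rfl hcop, ← mul_sum, ← coe_mul_zeta_apply, moebius_mul_coe_zeta, one_apply]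
  by_cases hm : m = 1
  · simp [hm]
  · simp [hm, hl0]

namespace BoundingSieve

variable (s : BoundingSieve) (R : ℕ)

/-- The sum of the Selberg terms over the divisors up to `R` of the sifting product. -/
def selbergSum : ℝ := ∑ l ∈ s.prodPrimes.divisors with l ≤ R, s.selbergTerms l

/-- The weights minimising the main term of the `Λ²` sieve among those supported up to `R`. -/
def selbergWeight (d : ℕ) : ℝ :=
  if d ∣ s.prodPrimes then
    μ d * (s.nu d)⁻¹ * (s.selbergSum R)⁻¹ *
      ∑ l ∈ s.prodPrimes.divisors with d ∣ l ∧ l ≤ R, s.selbergTerms l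
  else 0

variable {s R}

theorem selbergTerms_nonneg_of_mem {l : ℕ} (hl : l ∈ s.prodPrimes.divisors) :
    0 ≤ s.selbergTerms l :=
  (selbergTerms_pos (Nat.dvd_of_mem_divisors hl)).le

theorem selbergSum_pos (hR : 1 ≤ R) : 0 < s.selbergSum R :=
  sum_pos (fun l hl => selbergTerms_pos (Nat.dvd_of_mem_divisors (mem_filter.1 hl).1))
    ⟨1, by simp [hR, prodPrimes_ne_zero]⟩

theorem selbergWeight_one (hR : 1 ≤ R) : s.selbergWeight R 1 = 1 := by
  have h := (selbergSum_pos (s := s) hR).ne'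
  simp only [selbergWeight, one_dvd, if_true, true_and, s.nu_mult.map_one, moebius_apply_one]
  rw [← selbergSum]
  simp [h]

theorem selbergWeight_eq_zero {d : ℕ} (hd : R < d) : s.selbergWeight R d = 0 := by
  unfold selbergWeight
  split_ifs
  · rw [sum_eq_zero, mul_zero]
    intro l hl
    simp only [mem_filter, Nat.mem_divisors] at hl
    have := Nat.le_of_dvd (Nat.pos_of_ne_zero fun h => by simp_all) hl.2.1
    omega
  · rfl

theorem abs_selbergWeight_le (hR : 1 ≤ R) {d : ℕ} (hd : d ∣ s.prodPrimes) :
    |s.selbergWeight R d| ≤ (s.nu d)⁻¹ := by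
  have hG := selbergSum_pos (s := s) hR
  have hν := nu_pos_of_dvd_prodPrimes hd
  have hsum : ∑ l ∈ s.prodPrimes.divisors with d ∣ l ∧ l ≤ R, s.selbergTerms l ≤
      s.selbergSum R := by
    refine sum_le_sum_of_subset_of_nonneg ?_ fun l hl _ =>
      selbergTerms_nonneg_of_mem (mem_filter.1 hl).1
    intro l hl
    simp only [mem_filter] at hl ⊢
    exact ⟨hl.1, hl.2.2⟩
  have hsum0 : 0 ≤ ∑ l ∈ s.prodPrimes.divisors with d ∣ l ∧ l ≤ R, s.selbergTerms l :=
    sum_nonneg fun l hl => selbergTerms_nonneg_of_mem (mem_filter.1 hl).1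
  have hμ : |(μ d : ℝ)| ≤ 1 := by exact_mod_cast abs_moebius_le_one (n := d)
  rw [selbergWeight, if_pos hd, abs_mul, abs_mul, abs_mul, abs_of_nonneg hsum0,
    abs_of_pos (inv_pos.2 hG), abs_of_pos (inv_pos.2 hν)]
  calc _ ≤ 1 * (s.nu d)⁻¹ * (s.selbergSum R)⁻¹ * s.selbergSum R := by gcongr
    _ = _ := by field_simp

theorem sum_nu_mul_selbergWeight {l : ℕ} (hl : l ∣ s.prodPrimes) :
    (∑ d ∈ s.prodPrimes.divisors, if l ∣ d then s.nu d * s.selbergWeight R d else 0) =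
      if l ≤ R then (s.selbergSum R)⁻¹ * (s.selbergTerms l * μ l) else 0 := by
  have h1 : ∀ d ∈ s.prodPrimes.divisors,
      (if l ∣ d then s.nu d * s.selbergWeight R d else 0) =
      ∑ k ∈ s.prodPrimes.divisors, if k ≤ R then
        (s.selbergSum R)⁻¹ * s.selbergTerms k * (if l ∣ d ∧ d ∣ k then (μ d : ℝ) else 0)
        else 0 := by
    intro d hd
    have hdP := Nat.dvd_of_mem_divisors hd
    have hν := nu_ne_zero hdP
    by_cases hld : l ∣ d
    · rw [if_pos hld, selbergWeight, if_pos hdP]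
      rw [sum_filter, mul_sum, mul_sum]
      refine sum_congr rfl fun k _ => ?_
      by_cases h1 : d ∣ k <;> by_cases h2 : k ≤ R <;> simp [h1, h2, hld]
      field_simp
    · simp [hld]
  rw [sum_congr rfl h1, sum_comm]
  have h2 : ∀ k ∈ s.prodPrimes.divisors,
      (∑ d ∈ s.prodPrimes.divisors, if k ≤ R then
        (s.selbergSum R)⁻¹ * s.selbergTerms k * (if l ∣ d ∧ d ∣ k then (μ d : ℝ) else 0)
        else 0) = if k = l then (if l ≤ R then
          (s.selbergSum R)⁻¹ * (s.selbergTerms l * μ l) else 0) else 0 := by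
    intro k hk
    have hkP := Nat.dvd_of_mem_divisors hk
    by_cases hkR : k ≤ R
    · simp only [hkR, if_true]
      rw [← mul_sum]
      have h3 : (∑ d ∈ s.prodPrimes.divisors, if l ∣ d ∧ d ∣ k then (μ d : ℝ) else 0) =
          if k = l then (μ l : ℝ) else 0 := by
        rw [← sum_filter]
        have h4 : s.prodPrimes.divisors.filter (fun d => l ∣ d ∧ d ∣ k) =
            k.divisors.filter (l ∣ ·) := by
          ext d
          simp only [mem_filter, Nat.mem_divisors]
          constructor
          · rintro ⟨⟨_, _⟩, h, h'⟩
            exact ⟨⟨h', ne_zero_of_dvd_ne_zero prodPrimes_ne_zero hkP⟩, h⟩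
          · rintro ⟨⟨h, _⟩, h'⟩
            exact ⟨⟨h.trans hkP, prodPrimes_ne_zero⟩, h', h⟩
        rw [h4]
        by_cases hlk : l ∣ k
        · have := sum_moebius_between (squarefree_of_dvd_prodPrimes hkP) hlk
          exact_mod_cast this
        · rw [if_neg (by rintro rfl; exact hlk dvd_rfl), sum_eq_zero]
          intro d hd
          simp only [mem_filter, Nat.mem_divisors] at hd
          exact absurd (hd.2.trans hd.1.1) hlk
      rw [h3]
      by_cases hkl : k = l
      · subst hkl; simp [hkR]; ring
      · simp [hkl]
    · by_cases hkl : k = l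
      · subst hkl; simp [hkR]
      · simp [hkR, hkl]
  rw [sum_congr rfl h2, sum_ite_eq' s.prodPrimes.divisors l,
    if_pos (Nat.mem_divisors.2 ⟨hl, prodPrimes_ne_zero⟩)]

theorem mainSum_selbergWeight (hR : 1 ≤ R) :
    s.mainSum (lambdaSquared (s.selbergWeight R)) = (s.selbergSum R)⁻¹ := by
  have hG := (selbergSum_pos (s := s) hR).ne'
  rw [mainSum_lambdaSquared_eq_sum_mul_sum_sq]
  have h1 : ∀ l ∈ s.prodPrimes.divisors, (s.selbergTerms l)⁻¹ *
      (∑ d ∈ s.prodPrimes.divisors, if l ∣ d then s.nu d * s.selbergWeight R d else 0) ^ 2 =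
      (s.selbergSum R)⁻¹ ^ 2 * if l ≤ R then s.selbergTerms l else 0 := by
    intro l hl
    have hlP := Nat.dvd_of_mem_divisors hl
    have hg := (selbergTerms_pos hlP).ne'
    rw [sum_nu_mul_selbergWeight hlP]
    split_ifs
    · have hμ : (μ l : ℝ) ^ 2 = 1 := by
        exact_mod_cast moebius_sq_eq_one_of_squarefree (squarefree_of_dvd_prodPrimes hlP)
      rw [mul_pow, mul_pow, hμ]
      field_simp
    · simp
  rw [sum_congr rfl h1, ← mul_sum, ← sum_filter, ← selbergSum]
  field_simp

theorem abs_lambdaSquared_le {w : ℕ → ℝ} {B : ℝ} (hw : ∀ d, R < d → w d = 0)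
    {d : ℕ} (hB : ∀ e, e ∣ d → |w e| ≤ B) :
    |lambdaSquared w d| ≤ (R * B) ^ 2 := by
  have hB0 : 0 ≤ B := (abs_nonneg _).trans (hB 1 (one_dvd d))
  have key : ∑ e ∈ d.divisors, |w e| ≤ R * B := by
    have h0 : ∑ e ∈ d.divisors, |w e| = ∑ e ∈ d.divisors with e ≤ R, |w e| := by
      rw [sum_filter]
      refine sum_congr rfl fun e _ => ?_
      split_ifs with h
      · rfl
      · rw [hw e (by omega), abs_zero]
    rw [h0]
    calc _ ≤ ∑ e ∈ d.divisors with e ≤ R, B :=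
          sum_le_sum fun e he => hB e (Nat.dvd_of_mem_divisors (mem_filter.1 he).1)
      _ = #(d.divisors.filter (· ≤ R)) * B := by simp
      _ ≤ #(Icc 1 R) * B := by
          gcongr
          intro e he
          simp only [mem_filter] at he
          exact mem_Icc.2 ⟨Nat.pos_of_mem_divisors he.1, he.2⟩
      _ = R * B := by simp
  calc |lambdaSquared w d| ≤ ∑ d1 ∈ d.divisors, ∑ d2 ∈ d.divisors, |w d1| * |w d2| := by
        unfold lambdaSquared
        refine (abs_sum_le_sum_abs _ _).trans (sum_le_sum fun d1 _ => ?_)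
        refine (abs_sum_le_sum_abs _ _).trans (sum_le_sum fun d2 _ => ?_)
        split_ifs
        · rw [abs_mul]
        · simp; positivity
    _ = (∑ e ∈ d.divisors, |w e|) ^ 2 := by rw [sq, sum_mul_sum]
    _ ≤ _ := by gcongr

theorem lambdaSquared_eq_zero {w : ℕ → ℝ} (hw : ∀ d, R < d → w d = 0)
    {d : ℕ} (hd : R ^ 2 < d) : lambdaSquared w d = 0 := by
  unfold lambdaSquared
  refine sum_eq_zero fun d1 _ => sum_eq_zero fun d2 _ => ?_
  split_ifs with h
  · by_cases h1 : R < d1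
    · simp [hw d1 h1]
    · by_cases h2 : R < d2
      · simp [hw d2 h2]
      · have : d ≤ R ^ 2 := by
          rw [h, sq]
          exact (Nat.lcm_le_mul (Nat.pos_of_ne_zero (by rintro rfl; simp_all)) (Nat.pos_of_ne_zero (by rintro rfl; simp_all))).trans
            (Nat.mul_le_mul (by omega) (by omega))
        omega
  · rfl

/-- A crude form of Selberg's upper bound sieve. -/
theorem siftedSum_le_div_selbergSum (hR : 1 ≤ R)
    (hrem : ∀ d, d ∣ s.prodPrimes → |s.rem d| ≤ d)
    (hnu : ∀ d, d ∣ s.prodPrimes → (s.nu d)⁻¹ ≤ d) :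
    s.siftedSum ≤ s.totalMass / s.selbergSum R + (R : ℝ) ^ 8 := by
  have h := siftedSum_le_mainSum_errSum_of_upperMoebius (s := s) _
    (upperMoebius_lambdaSquared (s.selbergWeight R) (selbergWeight_one hR))
  rw [mainSum_selbergWeight hR, ← div_eq_mul_inv] at h
  refine h.trans (add_le_add le_rfl ?_)
  have hw : ∀ d, R < d → s.selbergWeight R d = 0 := fun d => selbergWeight_eq_zero
  have hB : ∀ d, d ∣ s.prodPrimes → |s.selbergWeight R d| ≤ R := by
    intro d hd
    by_cases hdR : R < d
    · rw [hw d hdR]; simp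
    · exact (abs_selbergWeight_le hR hd).trans ((hnu d hd).trans (by exact_mod_cast not_lt.1 hdR))
  have hterm : ∀ d ∈ s.prodPrimes.divisors,
      |lambdaSquared (s.selbergWeight R) d| * |s.rem d| ≤
      if d ≤ R ^ 2 then (R : ℝ) ^ 6 else 0 := by
    intro d hd
    have hdP := Nat.dvd_of_mem_divisors hd
    split_ifs with hdR
    · calc _ ≤ ((R : ℝ) * R) ^ 2 * (R : ℝ) ^ 2 := by
            gcongr
            · exact abs_lambdaSquared_le hw
                fun e he => hB e (he.trans hdP)
            · exact (hrem d hdP).trans (by exact_mod_cast hdR)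
        _ = _ := by ring
    · rw [lambdaSquared_eq_zero hw (by omega)]; simp
  calc s.errSum (lambdaSquared (s.selbergWeight R))
      ≤ ∑ d ∈ s.prodPrimes.divisors, if d ≤ R ^ 2 then (R : ℝ) ^ 6 else 0 := sum_le_sum hterm
    _ = #(s.prodPrimes.divisors.filter (· ≤ R ^ 2)) * (R : ℝ) ^ 6 := by
        rw [← sum_filter]; simp
    _ ≤ #(Icc 1 (R ^ 2)) * (R : ℝ) ^ 6 := by
        gcongr
        intro e he
        simp only [mem_filter] at he
        exact mem_Icc.2 ⟨Nat.pos_of_mem_divisors he.1, he.2⟩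
    _ = (R : ℝ) ^ 8 := by simp; ring

end BoundingSieve

end

section

open Finset ArithmeticFunction

/-- The sum of `∏ q ∈ T, g q` over the subsets `T` of `S` with product at most `z`. -/
def boundedSubsetSum (g : ℕ → ℝ) (S : Finset ℕ) (z : ℕ) : ℝ :=
  ∑ T ∈ S.powerset, if ∏ q ∈ T, q ≤ z then ∏ q ∈ T, g q else 0

theorem boundedSubsetSum_insert {g : ℕ → ℝ} {S : Finset ℕ} {q : ℕ} (hq : 0 < q) (hqS : q ∉ S)
    (z : ℕ) :
    boundedSubsetSum g (insert q S) z =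
      boundedSubsetSum g S z + g q * boundedSubsetSum g S (z / q) := by
  unfold boundedSubsetSum
  rw [sum_powerset_insert hqS, mul_sum]
  congr 1
  refine sum_congr rfl fun T hT => ?_
  have hqT : q ∉ T := fun h => hqS (mem_powerset.1 hT h)
  have hiff : q * ∏ x ∈ T, x ≤ z ↔ ∏ x ∈ T, x ≤ z / q := by
    rw [Nat.le_div_iff_mul_le hq, mul_comm]
  simp only [prod_insert hqT, hiff, mul_ite, mul_zero]

theorem boundedSubsetSum_mono {g : ℕ → ℝ} {S : Finset ℕ} (hg : ∀ q ∈ S, 0 ≤ g q) {y z : ℕ}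
    (hyz : y ≤ z) : boundedSubsetSum g S y ≤ boundedSubsetSum g S z := by
  refine sum_le_sum fun T hT => ?_
  have : 0 ≤ ∏ q ∈ T, g q := prod_nonneg fun q hq => hg q (mem_powerset.1 hT hq)
  split_ifs <;> first | omega | exact le_rfl

theorem sum_le_boundedSubsetSum {r f g : ℕ → ℝ} (hr : ∀ n, 0 ≤ r n) (hr1 : r 1 ≤ 1)
    (S : Finset ℕ) (hS : ∀ q ∈ S, q.Prime) (hf : ∀ q ∈ S, 0 ≤ f q) (hg : ∀ q ∈ S, 0 ≤ g q)
    (hfg : ∀ q ∈ S, f q * (1 + g q) ≤ g q)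
    (hrf : ∀ q ∈ S, ∀ n, 1 ≤ n → r (q * n) ≤ f q * r n) (z : ℕ) :
    ∑ n ∈ Icc 1 z with n.primeFactors ⊆ S, r n ≤ boundedSubsetSum g S z := by
  induction S using Finset.induction_on generalizing z with
  | empty =>
    have hsub : ((Icc 1 z).filter fun n => n.primeFactors ⊆ ∅) ⊆ (Icc 1 z).filter (· = 1) := by
      intro n hn
      simp only [mem_filter, mem_Icc, subset_empty, Nat.primeFactors_eq_empty] at hn ⊢
      exact ⟨hn.1, by omega⟩
    refine (sum_le_sum_of_subset_of_nonneg hsub fun n _ _ => hr n).trans ?_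
    rw [sum_filter, sum_ite_eq']
    by_cases hz : 1 ≤ z <;> simp [boundedSubsetSum, hz, hr1]
  | insert q S hqS ih =>
    have hqp := hS q (mem_insert_self q S)
    have hfq := hf q (mem_insert_self q S)
    have hgS : ∀ p ∈ S, 0 ≤ g p := fun p hp => hg p (mem_insert_of_mem hp)
    replace ih := ih (fun p hp => hS p (mem_insert_of_mem hp))
      (fun p hp => hf p (mem_insert_of_mem hp)) hgS (fun p hp => hfg p (mem_insert_of_mem hp))
      (fun p hp => hrf p (mem_insert_of_mem hp))
    induction z using Nat.strong_induction_on with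
    | _ z ihz =>
    have hsplit : ∑ n ∈ Icc 1 z with n.primeFactors ⊆ insert q S, r n ≤
        ∑ n ∈ Icc 1 z with n.primeFactors ⊆ S, r n +
        f q * ∑ n ∈ Icc 1 (z / q) with n.primeFactors ⊆ insert q S, r n := by
      rw [← sum_filter_not_add_sum_filter _ (fun n => q ∣ n)]
      refine add_le_add ?_ ?_
      · refine sum_le_sum_of_subset_of_nonneg ?_ fun n _ _ => hr n
        intro n hn
        simp only [mem_filter] at hn ⊢
        refine ⟨hn.1.1, fun p hp => ?_⟩
        rcases mem_insert.1 (hn.1.2 hp) with rfl | h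
        · exact absurd (Nat.dvd_of_mem_primeFactors hp) hn.2
        · exact h
      · rw [mul_sum]
        have hsub : ((Icc 1 z).filter fun n => n.primeFactors ⊆ insert q S).filter
            (fun n => q ∣ n) ⊆
            ((Icc 1 (z / q)).filter fun n => n.primeFactors ⊆ insert q S).image (q * ·) := by
          intro n hn
          simp only [mem_filter, mem_Icc, mem_image] at hn ⊢
          obtain ⟨⟨⟨h1, h2⟩, h3⟩, m, rfl⟩ := hn
          have hm : m ≠ 0 := by rintro rfl; omega
          refine ⟨m, ⟨⟨by omega, ?_⟩, ?_⟩, rfl⟩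
          · rw [Nat.le_div_iff_mul_le hqp.pos, mul_comm]; exact h2
          · exact (Nat.primeFactors_mono (dvd_mul_left m q) (by omega)).trans h3
        refine (sum_le_sum_of_subset_of_nonneg hsub fun n _ _ => hr n).trans ?_
        rw [sum_image fun a _ b _ h => Nat.eq_of_mul_eq_mul_left hqp.pos h]
        exact sum_le_sum fun n hn =>
          hrf q (mem_insert_self q S) n (mem_Icc.1 (mem_filter.1 hn).1).1
    rcases Nat.eq_zero_or_pos z with rfl | hz
    · have : 0 ≤ boundedSubsetSum g (insert q S) 0 := sum_nonneg fun T hT => by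
        have : 0 ≤ ∏ q ∈ T, g q := prod_nonneg fun q hq => hg q (mem_powerset.1 hT hq)
        split_ifs <;> simp [this]
      simpa using this
    have h1 := ihz (z / q) (Nat.div_lt_self hz hqp.one_lt)
    rw [boundedSubsetSum_insert hqp.pos hqS] at h1 ⊢
    have h2 := boundedSubsetSum_mono (g := g) hgS (Nat.div_le_self (z / q) q)
    have h3 := hg q (mem_insert_self q S)
    have h4 : 0 ≤ boundedSubsetSum g S (z / q) := sum_nonneg fun T hT => by
      have : 0 ≤ ∏ q ∈ T, g q := prod_nonneg fun q hq => hgS q (mem_powerset.1 hT hq)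
      split_ifs <;> simp [this]
    calc _ ≤ boundedSubsetSum g S z + f q * (boundedSubsetSum g S (z / q) +
          g q * boundedSubsetSum g S (z / q)) := by
            refine hsplit.trans (add_le_add (ih z) (mul_le_mul_of_nonneg_left (h1.trans ?_) hfq))
            gcongr
      _ = boundedSubsetSum g S z + f q * (1 + g q) * boundedSubsetSum g S (z / q) := by ring
      _ ≤ _ := by
        gcongr
        exact hfg q (mem_insert_self q S)

theorem BoundingSieve.boundedSubsetSum_le_selbergSum (s : BoundingSieve) (R : ℕ) :
    boundedSubsetSum s.selbergTerms s.prodPrimes.primeFactors R ≤ s.selbergSum R := by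
  unfold boundedSubsetSum BoundingSieve.selbergSum
  rw [← sum_filter]
  have hprime : ∀ T ⊆ s.prodPrimes.primeFactors, (∏ q ∈ T, q).primeFactors = T := fun T hT =>
    Nat.primeFactors_prod fun q hq => Nat.prime_of_mem_primeFactors (hT hq)
  have hterm : ∀ T ∈ s.prodPrimes.primeFactors.powerset.filter (fun T => ∏ q ∈ T, q ≤ R),
      ∏ q ∈ T, s.selbergTerms q = s.selbergTerms (∏ q ∈ T, q) := fun T hT =>
    (BoundingSieve.selbergTerms_isMultiplicative.map_prod_of_subset_primeFactors _ _
      (mem_powerset.1 (mem_filter.1 hT).1)).symm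
  rw [sum_congr rfl hterm]
  rw [← sum_image (f := fun l => s.selbergTerms l) (g := fun T : Finset ℕ => ∏ q ∈ T, q)]
  · refine sum_le_sum_of_subset_of_nonneg ?_ fun l hl _ =>
      BoundingSieve.selbergTerms_nonneg_of_mem (mem_filter.1 hl).1
    intro l hl
    simp only [mem_image, mem_filter, mem_powerset, Nat.mem_divisors] at hl ⊢
    obtain ⟨T, ⟨hT, hle⟩, rfl⟩ := hl
    refine ⟨⟨?_, BoundingSieve.prodPrimes_ne_zero⟩, hle⟩
    exact (prod_dvd_prod_of_subset _ _ _ hT).trans (Nat.prod_primeFactors_dvd _)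
  · intro T hT T' hT' h
    simp only [coe_filter, mem_powerset, Set.mem_ofPred_eq] at hT hT'
    rw [← hprime T hT.1, ← hprime T' hT'.1]
    exact congrArg Nat.primeFactors h

/-- A lower bound for the Selberg sum by a sum over all integers, not just squarefree ones. -/
theorem BoundingSieve.sum_le_selbergSum (s : BoundingSieve) {R : ℕ} {r : ℕ → ℝ}
    (hr : ∀ n, 0 ≤ r n) (hr1 : r 1 ≤ 1)
    (hrν : ∀ q, q.Prime → q ∣ s.prodPrimes → ∀ n, 1 ≤ n → r (q * n) ≤ s.nu q * r n)
    (hr0 : ∀ n, 1 ≤ n → n ≤ R → r n ≠ 0 → n.primeFactors ⊆ s.prodPrimes.primeFactors) :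
    ∑ n ∈ Icc 1 R, r n ≤ s.selbergSum R := by
  have hmem : ∀ q ∈ s.prodPrimes.primeFactors, q.Prime ∧ q ∣ s.prodPrimes := fun q hq =>
    ⟨Nat.prime_of_mem_primeFactors hq, Nat.dvd_of_mem_primeFactors hq⟩
  have h := sum_le_boundedSubsetSum (f := s.nu) (g := s.selbergTerms) hr hr1
    s.prodPrimes.primeFactors (fun q hq => (hmem q hq).1)
    (fun q hq => (s.nu_pos_of_prime q (hmem q hq).1 (hmem q hq).2).le)
    (fun q hq => (BoundingSieve.selbergTerms_pos (hmem q hq).2).le)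
    (fun q hq => by
      have := s.nu_lt_one_of_prime q (hmem q hq).1 (hmem q hq).2
      have h1 : 1 - s.nu q ≠ 0 := by linarith
      rw [BoundingSieve.selbergTerms_apply, (hmem q hq).1.primeFactors, prod_singleton]
      refine le_of_eq ?_
      field_simp
      ring)
    (fun q hq => hrν q (hmem q hq).1 (hmem q hq).2) R
  refine le_trans (le_of_eq ?_) (h.trans (s.boundedSubsetSum_le_selbergSum R))
  rw [sum_filter]
  refine sum_congr rfl fun n hn => ?_
  split_ifs with h'
  · rfl
  · by_contra h0
    exact h' (hr0 n (mem_Icc.1 hn).1 (mem_Icc.1 hn).2 h0)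

theorem prod_one_sub_inv_mul_sum_inv_le (S : Finset ℕ) (hS : ∀ q ∈ S, q.Prime) (N : ℕ) :
    (∏ q ∈ S, (1 - (q : ℝ)⁻¹)) * ∑ n ∈ Icc 1 N, (n : ℝ)⁻¹ ≤
      ∑ n ∈ Icc 1 N with ∀ q ∈ S, ¬ q ∣ n, (n : ℝ)⁻¹ := by
  induction S using Finset.induction_on with
  | empty => simp
  | insert q S hqS ih =>
    have hqp := hS q (mem_insert_self q S)
    have hq1 : (q : ℝ)⁻¹ ≤ 1 := inv_le_one_of_one_le₀ (by exact_mod_cast hqp.one_lt.le)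
    replace ih := ih fun p hp => hS p (mem_insert_of_mem hp)
    rw [prod_insert hqS, mul_assoc]
    refine (mul_le_mul_of_nonneg_left ih (by linarith)).trans ?_
    have hsplit := (sum_filter_not_add_sum_filter ((Icc 1 N).filter fun n => ∀ q ∈ S, ¬ q ∣ n)
      (fun n => q ∣ n) fun n => (n : ℝ)⁻¹).symm
    rw [sub_mul, one_mul, sub_le_iff_le_add]
    refine hsplit.le.trans ?_
    refine add_le_add ?_ ?_
    · refine sum_le_sum_of_subset_of_nonneg ?_ fun n _ _ => by positivity
      intro n hn
      simp only [mem_filter, mem_insert, forall_eq_or_imp] at hn ⊢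
      exact ⟨hn.1.1, hn.2, hn.1.2⟩
    · rw [mul_sum]
      have hsub : ((Icc 1 N).filter fun n => ∀ p ∈ S, ¬ p ∣ n).filter (fun n => q ∣ n) ⊆
          ((Icc 1 N).filter fun n => ∀ p ∈ S, ¬ p ∣ n).image (q * ·) := by
        intro n hn
        simp only [mem_filter, mem_Icc, mem_image] at hn ⊢
        obtain ⟨⟨⟨h1, h2⟩, h3⟩, m, rfl⟩ := hn
        have hm : m ≠ 0 := by rintro rfl; omega
        exact ⟨m, ⟨⟨by omega, (Nat.le_mul_of_pos_left m hqp.pos).trans h2⟩,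
          fun p hp h => h3 p hp (h.trans (dvd_mul_left m q))⟩, rfl⟩
      refine (sum_le_sum_of_subset_of_nonneg hsub fun n _ _ => by positivity).trans ?_
      rw [sum_image fun a _ b _ h => Nat.eq_of_mul_eq_mul_left hqp.pos h]
      exact sum_le_sum fun n _ => by push_cast; rw [mul_inv]

theorem totient_div_self_eq_prod {k : ℕ} (hk : k ≠ 0) :
    (k.totient / k : ℝ) = ∏ q ∈ k.primeFactors, (1 - (q : ℝ)⁻¹) := by
  have h2 : (k.totient : ℝ) = k * ∏ q ∈ k.primeFactors, (1 - (q : ℝ)⁻¹) := by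
    have h1 := congrArg (fun x : ℚ => (x : ℝ)) (Nat.totient_eq_mul_prod_factors k)
    push_cast at h1
    exact h1
  rw [h2]
  field_simp

theorem totient_div_mul_log_le {k : ℕ} (hk : k ≠ 0) (N : ℕ) :
    (k.totient / k : ℝ) * Real.log (N + 1) ≤
      ∑ n ∈ Icc 1 N with n.Coprime k, (n : ℝ)⁻¹ := by
  have h := prod_one_sub_inv_mul_sum_inv_le k.primeFactors
    (fun q hq => Nat.prime_of_mem_primeFactors hq) N
  have hlog : Real.log (N + 1) ≤ ∑ n ∈ Icc 1 N, (n : ℝ)⁻¹ := by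
    have := log_add_one_le_harmonic N
    rw [harmonic_eq_sum_Icc] at this
    push_cast at this
    exact this
  have hfil : (Icc 1 N).filter (fun n => n.Coprime k) =
      (Icc 1 N).filter (fun n => ∀ q ∈ k.primeFactors, ¬ q ∣ n) := by
    refine filter_congr fun n _ => ?_
    constructor
    · intro hc q hq hqn
      exact (Nat.prime_of_mem_primeFactors hq).one_lt.ne'
        (Nat.eq_one_of_dvd_coprimes hc hqn (Nat.dvd_of_mem_primeFactors hq))
    · intro h
      refine Nat.coprime_of_dvd fun q hq hqn hqk => ?_
      exact h q (Nat.mem_primeFactors.2 ⟨hq, hqk, hk⟩) hqn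
  rw [hfil, totient_div_self_eq_prod hk]
  refine le_trans (mul_le_mul_of_nonneg_left hlog ?_) h
  exact prod_nonneg fun q hq => sub_nonneg.2 (inv_le_one_of_one_le₀
    (by exact_mod_cast (Nat.prime_of_mem_primeFactors hq).one_lt.le))

theorem prod_one_sub_inv_sq_ge (S : Finset ℕ) (hS : ∀ q ∈ S, 2 ≤ q) :
    (1 / 2 : ℝ) ≤ ∏ q ∈ S, (1 - (q : ℝ)⁻¹ ^ 2) := by
  have hN : ∀ N : ℕ, (N + 2 : ℝ) / (2 * (N + 1)) = ∏ q ∈ Icc 2 (N + 1), (1 - (q : ℝ)⁻¹ ^ 2) := by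
    intro N
    induction N with
    | zero => simp
    | succ N ih =>
      rw [prod_Icc_succ_top (by omega), ← ih]
      push_cast
      field_simp
      ring
  have hfac : ∀ q : ℕ, 2 ≤ q → (0 : ℝ) ≤ 1 - (q : ℝ)⁻¹ ^ 2 ∧ 1 - (q : ℝ)⁻¹ ^ 2 ≤ 1 := by
    intro q hq
    have h1 : (q : ℝ)⁻¹ ≤ 1 := inv_le_one_of_one_le₀ (by exact_mod_cast (by omega : 1 ≤ q))
    have h0 : (0 : ℝ) ≤ (q : ℝ)⁻¹ := by positivity
    constructor <;> nlinarith
  have hsub : S ⊆ Icc 2 (S.sup id + 1) := fun q hq =>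
    mem_Icc.2 ⟨hS q hq, (le_sup (f := id) hq).trans (Nat.le_succ _)⟩
  calc (1 / 2 : ℝ) ≤ ((S.sup id : ℕ) + 2 : ℝ) / (2 * ((S.sup id : ℕ) + 1)) := by
        rw [div_le_div_iff₀ (by positivity) (by positivity)]; linarith
    _ = _ := hN _
    _ = (∏ q ∈ Icc 2 (S.sup id + 1) \ S, (1 - (q : ℝ)⁻¹ ^ 2)) *
          ∏ q ∈ S, (1 - (q : ℝ)⁻¹ ^ 2) := (prod_sdiff hsub).symm
    _ ≤ 1 * ∏ q ∈ S, (1 - (q : ℝ)⁻¹ ^ 2) := by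
        gcongr
        · exact prod_nonneg fun q hq => (hfac q (hS q hq)).1
        · exact prod_le_one (fun q hq => (hfac q (mem_Icc.1 (mem_sdiff.1 hq).1).1).1)
            fun q hq => (hfac q (mem_Icc.1 (mem_sdiff.1 hq).1).1).2
    _ = _ := one_mul _

theorem half_le_totient_div_mul_rhoZ {u : ℤ} (hu : u ≠ 0) :
    (1 / 2 : ℝ) ≤ u.natAbs.totient / u.natAbs * rhoZ u := by
  rw [totient_div_self_eq_prod (Int.natAbs_ne_zero.2 hu), rhoZ, ← prod_mul_distrib]
  refine (prod_one_sub_inv_sq_ge u.natAbs.primeFactors fun q hq =>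
    (Nat.prime_of_mem_primeFactors hq).two_le).trans (le_of_eq ?_)
  exact prod_congr rfl fun q _ => by ring

theorem one_le_rhoZ (u : ℤ) : 1 ≤ rhoZ u :=
  prod_induction _ (1 ≤ ·) (fun _ _ => one_le_mul_of_one_le_of_one_le) le_rfl fun q _ => by
    have : (0 : ℝ) ≤ 1 / q := by positivity
    linarith

end

section

open Finset ArithmeticFunction

theorem card_filter_Ico_add_mul_of_periodic {p : ℕ → Prop} [DecidablePred p] {d : ℕ}
    (hp : Function.Periodic p d) (M k : ℕ) :
    #{m ∈ Ico M (M + k * d) | p m} = k * d.count p := by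
  induction k with
  | zero => simp
  | succ k ih =>
    have h1 : Ico M (M + (k + 1) * d) = Ico M (M + k * d) ∪ Ico (M + k * d) (M + k * d + d) := by
      rw [Ico_union_Ico_eq_Ico (by omega) (by omega)]
      congr 1
      ring
    have h2 : Disjoint (Ico M (M + k * d)) (Ico (M + k * d) (M + k * d + d)) :=
      Ico_disjoint_Ico_consecutive _ _ _
    rw [h1, filter_union, card_union_of_disjoint (disjoint_filter_filter h2), ih, add_mul, one_mul]
    congr 1
    exact Nat.filter_Ico_card_eq_of_periodic (M + k * d) d p hp

theorem abs_card_filter_Ico_sub_le_of_periodic {p : ℕ → Prop} [DecidablePred p] {d : ℕ} (hd : 0 < d)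
    (hp : Function.Periodic p d) (M N : ℕ) :
    |(#{m ∈ Ico M (M + N) | p m} : ℝ) - (d.count p / d : ℝ) * N| ≤ d.count p := by
  have hlt := Nat.lt_div_mul_add (a := N) hd
  have hle := Nat.div_mul_le_self N d
  set k := N / d
  have h1 : k * d.count p ≤ #{m ∈ Ico M (M + N) | p m} := by
    rw [← card_filter_Ico_add_mul_of_periodic hp M]
    exact card_le_card (filter_subset_filter _ (Ico_subset_Ico le_rfl (by omega)))
  have h2 : #{m ∈ Ico M (M + N) | p m} ≤ (k + 1) * d.count p := by
    rw [← card_filter_Ico_add_mul_of_periodic hp M]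
    exact card_le_card (filter_subset_filter _ (Ico_subset_Ico le_rfl (by
      rw [add_mul, one_mul]; omega)))
  have hd' : (0 : ℝ) < d := by exact_mod_cast hd
  have hc : (0 : ℝ) ≤ d.count p := by positivity
  have h3 : (k : ℝ) * d.count p ≤ (d.count p / d : ℝ) * N := by
    rw [div_mul_eq_mul_div, le_div_iff₀ hd']
    have : (k * d : ℝ) ≤ N := by exact_mod_cast hle
    nlinarith
  have h4 : (d.count p / d : ℝ) * N ≤ (k + 1 : ℝ) * d.count p := by
    rw [div_mul_eq_mul_div, div_le_iff₀ hd']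
    have : (N : ℝ) ≤ k * d + d := by exact_mod_cast hlt.le
    nlinarith
  have h1' : (k : ℝ) * d.count p ≤ #{m ∈ Ico M (M + N) | p m} := by exact_mod_cast h1
  have h2' : (#{m ∈ Ico M (M + N) | p m} : ℝ) ≤ (k + 1) * d.count p := by exact_mod_cast h2
  rw [abs_le]
  constructor <;> linarith

/-- The product of the two terms `b + W m` and `b + W (m + v)` of the progression `b mod W`. -/
def pairProd (b W : ℕ) (v : ℤ) (m : ℕ) : ℤ := (b + W * m) * (b + W * (m + v))

/-- The number of residue classes modulo `d` in which `pairProd b W v` is divisible by `d`. -/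
def rootCount (b W : ℕ) (v : ℤ) (d : ℕ) : ℕ :=
  Nat.card {x : ZMod d // ((b : ZMod d) + W * x) * (b + W * (x + v)) = 0}

variable {b W : ℕ} {v : ℤ}

theorem periodic_dvd_pairProd (d : ℕ) :
    Function.Periodic (fun m => (d : ℤ) ∣ pairProd b W v m) d := by
  intro m
  simp only [pairProd, ← ZMod.intCast_zmod_eq_zero_iff_dvd]
  push_cast
  simp

theorem count_dvd_pairProd {d : ℕ} [DecidablePred fun m => (d : ℤ) ∣ pairProd b W v m] (hd : 0 < d) :
    d.count (fun m => (d : ℤ) ∣ pairProd b W v m) = rootCount b W v d := by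
  have : NeZero d := ⟨hd.ne'⟩
  rw [Nat.count_eq_card_filter_range, rootCount, Nat.card_eq_fintype_card, Fintype.card_subtype]
  have hiff : ∀ m : ℕ, (d : ℤ) ∣ pairProd b W v m ↔
      ((b : ZMod d) + W * m) * (b + W * (m + v)) = 0 := by
    intro m
    rw [← ZMod.intCast_zmod_eq_zero_iff_dvd, pairProd]
    push_cast
    rfl
  refine card_nbij' (fun m => (m : ZMod d)) ZMod.val ?_ ?_ ?_ ?_
  · intro m hm
    simp only [coe_filter, mem_range, Set.mem_ofPred_eq, mem_univ, true_and] at hm ⊢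
    exact (hiff m).1 hm.2
  · intro x hx
    simp only [coe_filter, mem_range, Set.mem_ofPred_eq, mem_univ, true_and] at hx ⊢
    refine ⟨ZMod.val_lt x, (hiff _).2 ?_⟩
    rwa [ZMod.natCast_zmod_val]
  · intro m hm
    simp only [coe_filter, mem_range, Set.mem_ofPred_eq] at hm
    exact ZMod.val_cast_of_lt hm.1
  · intro x _
    exact ZMod.natCast_zmod_val x

theorem rootCount_one : rootCount b W v 1 = 1 := by
  rw [rootCount, Nat.card_eq_one_iff_unique]
  exact ⟨⟨fun _ _ => Subsingleton.elim _ _⟩, ⟨0, Subsingleton.elim _ _⟩⟩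

theorem rootCount_mul {d e : ℕ} (h : d.Coprime e) :
    rootCount b W v (d * e) = rootCount b W v d * rootCount b W v e := by
  unfold rootCount
  rw [← Nat.card_prod]
  let φ := ZMod.chineseRemainder h
  have hφ : ∀ x : ZMod (d * e), ((b : ZMod (d * e)) + W * x) * (b + W * (x + v)) = 0 ↔
      ((b : ZMod d) + W * (φ x).1) * (b + W * ((φ x).1 + v)) = 0 ∧
      ((b : ZMod e) + W * (φ x).2) * (b + W * ((φ x).2 + v)) = 0 := by
    intro x
    rw [← map_eq_zero_iff φ φ.injective, Prod.ext_iff]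
    simp
  refine Nat.card_congr ((φ.toEquiv.subtypeEquiv (q := fun y : ZMod d × ZMod e =>
    ((b : ZMod d) + W * y.1) * (b + W * (y.1 + v)) = 0 ∧
      ((b : ZMod e) + W * y.2) * (b + W * (y.2 + v)) = 0) hφ).trans ?_)
  exact Equiv.subtypeProdEquivProd
    (p := fun x : ZMod d => ((b : ZMod d) + W * x) * (b + W * (x + v)) = 0)
    (q := fun x : ZMod e => ((b : ZMod e) + W * x) * (b + W * (x + v)) = 0)

theorem rootCount_prime {p : ℕ} (hp : p.Prime) (hpW : ¬ p ∣ W) :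
    rootCount b W v p = if (p : ℤ) ∣ v then 1 else 2 := by
  have := Fact.mk hp
  have hW : (W : ZMod p) ≠ 0 := by rwa [Ne, ZMod.natCast_eq_zero_iff]
  rw [rootCount, Nat.card_eq_fintype_card, Fintype.card_subtype]
  have hset : (univ.filter fun x : ZMod p => ((b : ZMod p) + W * x) * (b + W * (x + v)) = 0) =
      {-(b : ZMod p) / W, -(b : ZMod p) / W - v} := by
    ext x
    simp only [mem_filter, mem_univ, true_and, mem_insert, mem_singleton, mul_eq_zero]
    refine or_congr ?_ ?_
    · rw [eq_div_iff hW]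
      constructor <;> intro h <;> linear_combination h
    · rw [eq_sub_iff_add_eq, eq_div_iff hW]
      constructor <;> intro h <;> linear_combination h
  rw [hset]
  split_ifs with hv
  · rw [(ZMod.intCast_zmod_eq_zero_iff_dvd v p).2 hv]
    simp
  · rw [card_pair]
    rw [← ZMod.intCast_zmod_eq_zero_iff_dvd] at hv
    intro h
    apply hv
    linear_combination h

/-- The density of the integers `m` with `d ∣ pairProd b W v m`. -/
def rootDensity (b W : ℕ) (v : ℤ) : ArithmeticFunction ℝ :=
  ⟨fun d => rootCount b W v d / d, by simp⟩

theorem rootDensity_apply (d : ℕ) : rootDensity b W v d = rootCount b W v d / d := rfl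

theorem isMultiplicative_rootDensity : (rootDensity b W v).IsMultiplicative := by
  refine ⟨by simp [rootDensity_apply, rootCount_one], fun {d e} h => ?_⟩
  simp only [rootDensity_apply, rootCount_mul h]
  push_cast
  rw [mul_div_mul_comm]

/-- The product of the primes up to `z` not dividing `W`. -/
def sievingProd (W z : ℕ) : ℕ := ∏ p ∈ Icc 1 z with p.Prime ∧ ¬ p ∣ W, p

theorem prime_dvd_sievingProd {z p : ℕ} (hp : p.Prime) :
    p ∣ sievingProd W z ↔ p ≤ z ∧ ¬ p ∣ W := by
  constructor
  · intro h
    obtain ⟨q, hq, hpq⟩ := (hp.prime.dvd_finsetProd_iff _).1 h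
    simp only [mem_filter, mem_Icc] at hq
    rw [Nat.prime_dvd_prime_iff_eq hp hq.2.1] at hpq
    subst hpq
    exact ⟨hq.1.2, hq.2.2⟩
  · rintro ⟨h1, h2⟩
    exact dvd_prod_of_mem _ (mem_filter.2 ⟨mem_Icc.2 ⟨hp.one_lt.le, h1⟩, hp, h2⟩)

theorem squarefree_sievingProd (z : ℕ) : Squarefree (sievingProd W z) := by
  refine Finset.squarefree_prod_of_pairwise_isCoprime ?_ ?_
  · intro p hp q hq hpq
    simp only [coe_filter, Set.mem_ofPred_eq] at hp hq
    exact Nat.coprime_iff_isRelPrime.1 ((Nat.coprime_primes hp.2.1 hq.2.1).2 hpq)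
  · intro p hp
    exact (mem_filter.1 hp).2.1.prime.squarefree

/-- The sieve problem for the product of two terms at distance `W v` in a progression mod `W`. -/
def pairSieve (b W : ℕ) (v : ℤ) (M N z : ℕ) (hv : (2 : ℤ) ∣ W * v) : BoundingSieve where
  support := (Ico M (M + N)).image fun m => (pairProd b W v m).natAbs
  prodPrimes := sievingProd W z
  prodPrimes_squarefree := squarefree_sievingProd z
  weights n := #{m ∈ Ico M (M + N) | (pairProd b W v m).natAbs = n}
  weights_nonneg _ := Nat.cast_nonneg _
  totalMass := N
  nu := rootDensity b W v
  nu_mult := isMultiplicative_rootDensity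
  nu_pos_of_prime p hp hpP := by
    have h0 : (0 : ℝ) < p := by exact_mod_cast hp.pos
    rw [rootDensity_apply, rootCount_prime hp ((prime_dvd_sievingProd hp).1 hpP).2]
    split_ifs <;> push_cast <;> positivity
  nu_lt_one_of_prime p hp hpP := by
    have h0 : (0 : ℝ) < p := by exact_mod_cast hp.pos
    have hpW := ((prime_dvd_sievingProd hp).1 hpP).2
    rw [rootDensity_apply, rootCount_prime hp hpW, div_lt_one h0]
    split_ifs with h
    · exact_mod_cast hp.one_lt
    · refine Nat.cast_lt.2 (lt_of_le_of_ne hp.two_le ?_)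
      rintro rfl
      rcases Int.prime_two.dvd_or_dvd hv with h' | h'
      · exact hpW (by exact_mod_cast h')
      · exact h (by exact_mod_cast h')

theorem sum_image_ite_card_fiber (A : Finset ℕ) (f : ℕ → ℕ) (Q : ℕ → Prop)
    [DecidablePred Q] :
    (∑ n ∈ A.image f, if Q n then (#{m ∈ A | f m = n} : ℝ) else 0) = #{m ∈ A | Q (f m)} := by
  rw [← sum_filter, ← Nat.cast_sum]
  congr 1
  rw [card_eq_sum_card_fiberwise (f := f) (t := (A.image f).filter Q)]
  · refine sum_congr rfl fun n hn => ?_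
    congr 1
    ext m
    simp only [mem_filter]
    constructor
    · rintro ⟨h1, rfl⟩
      exact ⟨⟨h1, (mem_filter.1 hn).2⟩, rfl⟩
    · rintro ⟨⟨h1, _⟩, h2⟩
      exact ⟨h1, h2⟩
  · intro m hm
    simp only [coe_filter, mem_image, Set.mem_ofPred_eq] at hm ⊢
    exact ⟨⟨m, hm.1, rfl⟩, hm.2⟩

variable {M N z : ℕ} {hv : (2 : ℤ) ∣ W * v}

theorem siftedSum_pairSieve : (pairSieve b W v M N z hv).siftedSum =
    #{m ∈ Ico M (M + N) | (sievingProd W z).Coprime (pairProd b W v m).natAbs} := by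
  rw [← sum_image_ite_card_fiber (Ico M (M + N)) (fun m => (pairProd b W v m).natAbs)
    (sievingProd W z).Coprime]
  rfl

theorem multSum_pairSieve (d : ℕ) : (pairSieve b W v M N z hv).multSum d =
    #{m ∈ Ico M (M + N) | (d : ℤ) ∣ pairProd b W v m} := by
  simp only [Int.natCast_dvd]
  rw [← sum_image_ite_card_fiber (Ico M (M + N)) (fun m => (pairProd b W v m).natAbs)
    fun n => d ∣ n]
  rfl

theorem rootCount_le {d : ℕ} (hd : 0 < d) : rootCount b W v d ≤ d := by
  rw [← count_dvd_pairProd hd]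
  exact Nat.count_le _

theorem abs_rem_pairSieve_le {d : ℕ} (hd : d ∣ sievingProd W z) :
    |(pairSieve b W v M N z hv).rem d| ≤ d := by
  have hd0 : 0 < d := Nat.pos_of_ne_zero
    (ne_zero_of_dvd_ne_zero (squarefree_sievingProd z).ne_zero hd)
  have h := abs_card_filter_Ico_sub_le_of_periodic hd0
    (periodic_dvd_pairProd (b := b) (W := W) (v := v) d) M N
  rw [count_dvd_pairProd hd0] at h
  rw [BoundingSieve.rem, multSum_pairSieve]
  exact h.trans (by exact_mod_cast rootCount_le hd0)

theorem inv_nu_pairSieve_le {d : ℕ} (hd : d ∣ sievingProd W z) :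
    ((pairSieve b W v M N z hv).nu d)⁻¹ ≤ d := by
  have hpos := BoundingSieve.nu_pos_of_dvd_prodPrimes (s := pairSieve b W v M N z hv) hd
  change 0 < (rootCount b W v d / d : ℝ) at hpos
  change (rootCount b W v d / d : ℝ)⁻¹ ≤ d
  have h1 : rootCount b W v d ≠ 0 := fun h => by simp [h] at hpos
  have h2 : (1 : ℝ) ≤ rootCount b W v d := by exact_mod_cast Nat.one_le_iff_ne_zero.2 h1
  rw [inv_div]
  exact div_le_self (by positivity) h2

end

section

open Finset ArithmeticFunction

variable {b W : ℕ} {v : ℤ}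

/-- The factorisations `n = a * c` with `a` coprime to `k` and `c` coprime to `l`. -/
def coprimeFactorizations (k l n : ℕ) : Finset (ℕ × ℕ) :=
  {x ∈ n.divisorsAntidiagonal | x.1.Coprime k ∧ x.2.Coprime l}

theorem mem_coprimeFactorizations {k l n : ℕ} {x : ℕ × ℕ} :
    x ∈ coprimeFactorizations k l n ↔
      (x.1 * x.2 = n ∧ n ≠ 0) ∧ x.1.Coprime k ∧ x.2.Coprime l := by
  simp [coprimeFactorizations]

theorem card_coprimeFactorizations_prime_mul_le {k l q n : ℕ} (hq : q.Prime) (hn : n ≠ 0) :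
    #(coprimeFactorizations k l (q * n)) ≤
      (if q ∣ l then 1 else 2) * #(coprimeFactorizations k l n) := by
  have hleft : ∀ x ∈ coprimeFactorizations k l (q * n), q ∣ x.1 →
      x ∈ (coprimeFactorizations k l n).image fun y => (q * y.1, y.2) := by
    rintro ⟨a, c⟩ hx hqx
    obtain ⟨a, rfl⟩ : q ∣ a := hqx
    simp only [mem_coprimeFactorizations, mem_image] at hx ⊢
    refine ⟨(a, c), ⟨⟨?_, hn⟩, hx.2.1.coprime_mul_left, hx.2.2⟩, rfl⟩
    exact Nat.eq_of_mul_eq_mul_left hq.pos (by rw [← mul_assoc]; exact hx.1.1)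
  have hright : ∀ x ∈ coprimeFactorizations k l (q * n), q ∣ x.2 →
      x ∈ (coprimeFactorizations k l n).image fun y => (y.1, q * y.2) := by
    rintro ⟨a, c⟩ hx hqx
    obtain ⟨c, rfl⟩ : q ∣ c := hqx
    simp only [mem_coprimeFactorizations, mem_image] at hx ⊢
    refine ⟨(a, c), ⟨⟨?_, hn⟩, hx.2.1, hx.2.2.coprime_mul_left⟩, rfl⟩
    exact Nat.eq_of_mul_eq_mul_left hq.pos (by rw [mul_left_comm]; exact hx.1.1)
  have hdvd : ∀ x ∈ coprimeFactorizations k l (q * n), q ∣ x.1 ∨ q ∣ x.2 := by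
    intro x hx
    rw [mem_coprimeFactorizations] at hx
    exact hq.dvd_mul.1 (hx.1.1 ▸ dvd_mul_right q n)
  split_ifs with hql
  · rw [one_mul]
    refine (card_le_card fun x hx => hleft x hx ?_).trans card_image_le
    refine (hdvd x hx).resolve_right fun h => ?_
    exact hq.one_lt.ne' (Nat.eq_one_of_dvd_coprimes (mem_coprimeFactorizations.1 hx).2.2 h hql)
  · have hsub : coprimeFactorizations k l (q * n) ⊆
        ((coprimeFactorizations k l n).image fun y => (q * y.1, y.2)) ∪
        ((coprimeFactorizations k l n).image fun y => (y.1, q * y.2)) := fun x hx =>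
      mem_union.2 ((hdvd x hx).imp (hleft x hx) (hright x hx))
    calc _ ≤ _ := card_le_card hsub
      _ ≤ _ := card_union_le _ _
      _ ≤ _ := add_le_add card_image_le card_image_le
      _ = _ := (two_mul _).symm

theorem sum_mul_sum_le_sum_coprimeFactorizations (k l N : ℕ) :
    (∑ a ∈ Icc 1 N with a.Coprime k, (a : ℝ)⁻¹) * (∑ c ∈ Icc 1 N with c.Coprime l, (c : ℝ)⁻¹) ≤
      ∑ n ∈ Icc 1 (N ^ 2), (#(coprimeFactorizations k l n) : ℝ) * (n : ℝ)⁻¹ := by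
  rw [sum_mul_sum, ← sum_product',
    ← sum_fiberwise_of_maps_to (g := fun x : ℕ × ℕ => x.1 * x.2) (t := Icc 1 (N ^ 2))]
  · refine sum_le_sum fun n hn => ?_
    have hn0 : n ≠ 0 := by have := (mem_Icc.1 hn).1; omega
    rw [← nsmul_eq_mul, ← sum_const]
    have hterm : ∀ x ∈ (((Icc 1 N).filter fun a => a.Coprime k) ×ˢ
        ((Icc 1 N).filter fun c => c.Coprime l)).filter (fun x => x.1 * x.2 = n),
        (x.1 : ℝ)⁻¹ * (x.2 : ℝ)⁻¹ = (n : ℝ)⁻¹ := by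
      intro x hx
      rw [← (mem_filter.1 hx).2]
      push_cast
      rw [mul_inv]
    rw [sum_congr rfl hterm]
    refine sum_le_sum_of_subset_of_nonneg ?_ fun _ _ _ => by positivity
    intro x hx
    simp only [mem_filter, mem_product] at hx
    exact mem_coprimeFactorizations.2 ⟨⟨hx.2, hn0⟩, hx.1.1.2, hx.1.2.2⟩
  · intro x hx
    simp only [mem_product, mem_filter, mem_Icc] at hx
    refine mem_Icc.2 ⟨Nat.mul_pos hx.1.1.1 hx.2.1.1, ?_⟩
    rw [sq]
    exact Nat.mul_le_mul hx.1.1.2 hx.2.1.2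

theorem sum_coprimeFactorizations_le_selbergSum {M N z : ℕ} {hv : (2 : ℤ) ∣ W * v} :
    ∑ n ∈ Icc 1 z, (#(coprimeFactorizations W (W * v).natAbs n) : ℝ) * (n : ℝ)⁻¹ ≤
      (pairSieve b W v M N z hv).selbergSum z := by
  refine BoundingSieve.sum_le_selbergSum _ (fun n => by positivity) ?_ ?_ ?_
  · have : #(coprimeFactorizations W (W * v).natAbs 1) ≤ 1 :=
      (card_filter_le _ _).trans (by simp)
    simpa using this
  · intro q hq hqP n hn
    have hqW := ((prime_dvd_sievingProd hq).1 hqP).2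
    have hcard := card_coprimeFactorizations_prime_mul_le (k := W) (l := (W * v).natAbs) hq
      (by omega : n ≠ 0)
    have hiff : q ∣ (W * v).natAbs ↔ (q : ℤ) ∣ v := by
      rw [← Int.natCast_dvd, (Nat.prime_iff_prime_int.1 hq).dvd_mul]
      exact or_iff_right fun h => hqW (by exact_mod_cast h)
    simp only [hiff] at hcard
    change _ ≤ (rootCount b W v q / q : ℝ) * _
    rw [rootCount_prime hq hqW]
    have hcard' : (#(coprimeFactorizations W (W * v).natAbs (q * n)) : ℝ) ≤
        ((if (q : ℤ) ∣ v then 1 else 2 : ℕ) : ℝ) *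
          #(coprimeFactorizations W (W * v).natAbs n) := by exact_mod_cast hcard
    calc _ ≤ ((if (q : ℤ) ∣ v then 1 else 2 : ℕ) : ℝ) *
          #(coprimeFactorizations W (W * v).natAbs n) * ((q * n : ℕ) : ℝ)⁻¹ := by gcongr
      _ = _ := by push_cast; rw [mul_inv]; ring
  · intro n hn hnz hne p hp
    have hpp := Nat.prime_of_mem_primeFactors hp
    have hpn := Nat.dvd_of_mem_primeFactors hp
    have hne' : #(coprimeFactorizations W (W * v).natAbs n) ≠ 0 := fun h => by simp [h] at hne
    obtain ⟨x, hx⟩ := card_ne_zero.1 hne'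
    rw [mem_coprimeFactorizations] at hx
    have hpW : ¬ p ∣ W := by
      intro hpW
      rcases hpp.dvd_mul.1 (hx.1.1.symm ▸ hpn) with h | h
      · exact hpp.one_lt.ne' (Nat.eq_one_of_dvd_coprimes hx.2.1 h hpW)
      · refine hpp.one_lt.ne' (Nat.eq_one_of_dvd_coprimes hx.2.2 h ?_)
        rw [Int.natAbs_mul, Int.natAbs_natCast]
        exact hpW.mul_right _
    exact Nat.mem_primeFactors.2 ⟨hpp, (prime_dvd_sievingProd hpp).2
      ⟨(Nat.le_of_dvd hn hpn).trans hnz, hpW⟩, (squarefree_sievingProd z).ne_zero⟩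

/-- Sieve bound for the `m` in an interval with `(b + W m) (b + W (m + v))` free of small primes. -/
theorem card_coprime_pairProd_le (hW : W ≠ 0) (hv0 : v ≠ 0) (hv : (2 : ℤ) ∣ W * v) (M N : ℕ)
    {y : ℕ} (hy : 1 ≤ y) :
    (#{m ∈ Ico M (M + N) | (sievingProd W (y ^ 2)).Coprime (pairProd b W v m).natAbs} : ℝ) ≤
      2 * N * W * rhoZ (W * v) / (W.totient * Real.log (y + 1) ^ 2) + (y : ℝ) ^ 16 := by
  have hu : (W * v : ℤ) ≠ 0 := mul_ne_zero (by exact_mod_cast hW) hv0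
  have hsieve := BoundingSieve.siftedSum_le_div_selbergSum (s := pairSieve b W v M N (y ^ 2) hv)
    (R := y ^ 2) (Nat.one_le_pow _ _ hy) (fun d => abs_rem_pairSieve_le)
    (fun d => inv_nu_pairSieve_le)
  rw [siftedSum_pairSieve] at hsieve
  refine hsieve.trans (add_le_add ?_ (le_of_eq (by push_cast; ring)))
  have hlog : 0 < Real.log (y + 1) := Real.log_pos (by
    have : (1 : ℝ) ≤ y := by exact_mod_cast hy
    linarith)
  have hφ : (0 : ℝ) < W.totient := by exact_mod_cast Nat.totient_pos.2 (Nat.pos_of_ne_zero hW)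
  have hW' : (0 : ℝ) < W := by exact_mod_cast Nat.pos_of_ne_zero hW
  have hG : (W.totient / W : ℝ) * Real.log (y + 1) *
      (((W * v).natAbs.totient / (W * v).natAbs : ℝ) * Real.log (y + 1)) ≤
      (pairSieve b W v M N (y ^ 2) hv).selbergSum (y ^ 2) := by
    refine le_trans ?_ ((sum_mul_sum_le_sum_coprimeFactorizations W (W * v).natAbs y).trans
      sum_coprimeFactorizations_le_selbergSum)
    exact mul_le_mul (totient_div_mul_log_le hW y)
      (totient_div_mul_log_le (Int.natAbs_ne_zero.2 hu) y) (by positivity)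
      (sum_nonneg fun _ _ => by positivity)
  have hρ := half_le_totient_div_mul_rhoZ hu
  have hρ0 : 0 < rhoZ (W * v) := one_pos.trans_le (one_le_rhoZ _)
  have hGpos := BoundingSieve.selbergSum_pos (s := pairSieve b W v M N (y ^ 2) hv)
    (Nat.one_le_pow 2 y hy)
  change (N : ℝ) / _ ≤ _
  rw [div_le_div_iff₀ hGpos (by positivity)]
  set τ : ℝ := (W * v).natAbs.totient / (W * v).natAbs
  have h1 : W.totient * Real.log (y + 1) ^ 2 ≤
      2 * W * rhoZ (W * v) * (pairSieve b W v M N (y ^ 2) hv).selbergSum (y ^ 2) := by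
    calc W.totient * Real.log (y + 1) ^ 2
        = 2 * W * (W.totient / W * Real.log (y + 1) * Real.log (y + 1)) * (1 / 2) := by
          field_simp
      _ ≤ 2 * W * (W.totient / W * Real.log (y + 1) * Real.log (y + 1)) *
          (τ * rhoZ (W * v)) := by gcongr
      _ = 2 * W * rhoZ (W * v) *
          (W.totient / W * Real.log (y + 1) * (τ * Real.log (y + 1))) := by ring
      _ ≤ _ := by gcongr
  calc (N : ℝ) * (W.totient * Real.log (y + 1) ^ 2)
      ≤ N * (2 * W * rhoZ (W * v) * (pairSieve b W v M N (y ^ 2) hv).selbergSum (y ^ 2)) := by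
        gcongr
    _ = _ := by ring

end

section

open Finset

theorem coprime_sievingProd_of_prime {W z p : ℕ} (hp : p.Prime) (hz : z < p) :
    (sievingProd W z).Coprime p :=
  ((Nat.Prime.coprime_iff_not_dvd hp).2 fun h =>
    absurd ((prime_dvd_sievingProd hp).1 h).1 (not_le.2 hz)).symm

theorem twinCount_eq_zero_of_odd {b W K : ℕ} {Y0 Y : ℝ} {v : ℤ} (hY0 : 2 ≤ Y0)
    (hv : ¬ (2 : ℤ) ∣ W * v) : TwinCount b W Y0 Y v K = 0 := by
  rw [TwinCount, card_eq_zero, filter_eq_empty_iff]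
  rintro ⟨p₁, p₂⟩ - ⟨h1, h2, h3, -, h4, -, -, -, h5⟩
  have h3' : 2 < p₁ := by exact_mod_cast hY0.trans_lt h3
  have h4' : 2 < p₂ := by exact_mod_cast hY0.trans_lt h4
  have o1 := h1.eq_two_or_odd
  have o2 := h2.eq_two_or_odd
  simp only at h5
  omega

theorem twinCount_le_card_coprime {b W K z : ℕ} {Y0 Y : ℝ} {v : ℤ} (hb : b < W) (hz : z ≤ Y0) :
    TwinCount b W Y0 Y v K ≤
      #{m ∈ Ico ⌈(Y0 - b) / W⌉₊ (⌈(Y0 - b) / W⌉₊ + (⌊Y / W⌋₊ + 1)) |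
        (sievingProd W z).Coprime (pairProd b W v m).natAbs} := by
  have hW : (0 : ℝ) < W := by exact_mod_cast (Nat.zero_le b).trans_lt hb
  have hp2 : ∀ p : ℕ, p ≡ b [MOD W] → p = b + W * (p / W) := by
    intro p hp
    have h1 := Nat.mod_add_div p W
    rw [hp, Nat.mod_eq_of_lt hb] at h1
    exact h1.symm
  refine card_le_card_of_injOn (fun x => x.2 / W) ?_ ?_
  · rintro ⟨p₁, p₂⟩ hx
    simp only [coe_filter, Set.mem_ofPred_eq] at hx
    obtain ⟨-, h1, h2, h3, -, h4, h5, -, h6, h7⟩ := hx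
    have h8 := hp2 p₂ h6
    simp only [coe_filter, Set.mem_ofPred_eq, mem_Ico]
    set m := p₂ / W
    have h8' : (p₂ : ℝ) = b + W * m := by exact_mod_cast h8
    refine ⟨⟨?_, ?_⟩, ?_⟩
    · rw [Nat.ceil_le, div_le_iff₀ hW]
      linarith
    · have h9 : (m : ℝ) < ⌈(Y0 - b) / W⌉₊ + (⌊Y / W⌋₊ + 1) := by
        have h10 := Nat.le_ceil ((Y0 - b) / W)
        have h11 := Nat.lt_floor_add_one (Y / W)
        have h12 : (m : ℝ) ≤ (Y0 - b) / W + Y / W := by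
          rw [← add_div, le_div_iff₀ hW]
          linarith
        linarith
      exact_mod_cast h9
    · have h9 : pairProd b W v m = (p₂ * p₁ : ℕ) := by
        have h8z : (p₂ : ℤ) = b + W * m := by exact_mod_cast h8
        rw [pairProd]
        push_cast
        rw [← h8z]
        congr 1
        linear_combination -h7 - h8z
      rw [h9, Int.natAbs_natCast]
      exact (coprime_sievingProd_of_prime h2 (by exact_mod_cast hz.trans_lt h4)).mul_right
        (coprime_sievingProd_of_prime h1 (by exact_mod_cast hz.trans_lt h3))
  · rintro ⟨p₁, p₂⟩ hx ⟨q₁, q₂⟩ hy hxy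
    simp only [coe_filter, Set.mem_ofPred_eq] at hx hy hxy
    obtain ⟨-, -, -, -, -, -, -, -, h6, h7⟩ := hx
    obtain ⟨-, -, -, -, -, -, -, -, k6, k7⟩ := hy
    have h : p₂ = q₂ := by rw [hp2 p₂ h6, hp2 q₂ k6, hxy]
    subst h
    have : p₁ = q₁ := by omega
    rw [this]

end

theorem statement16 :
    ∃ C > 0, ∃ X0 : ℝ, ∀ X : ℝ, X0 ≤ X →
      ∀ Y0 Y : ℝ, X / 2 ≤ Y0 → 0 < Y → Y0 + Y ≤ X → X / Real.log X < Y →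
      ∀ b W : ℕ, b < W → (W : ℝ) ≤ Real.log X → Nat.gcd b W = 1 →
      ∀ v : ℤ, v ≠ 0 →
        (TwinCount b W Y0 Y v ⌊X⌋₊ : ℝ) ≤
          C * (Y / ((Nat.totient W : ℝ) * Real.log X ^ 2)) * rhoZ ((W : ℤ) * v) := by
  have hlarge : ∀ᶠ X : ℝ in Filter.atTop, Real.log X ^ 8 ≤ X ∧ 1 ≤ Real.log X ∧ 16 ≤ X := by
    have h1 := (Real.isLittleO_pow_log_id_atTop (n := 8)).bound one_pos
    filter_upwards [h1, Real.tendsto_log_atTop.eventually_ge_atTop 1,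
      Filter.eventually_ge_atTop 16] with X h1 h2 h3
    refine ⟨?_, h2, h3⟩
    rw [Real.norm_of_nonneg (by positivity), id, Real.norm_of_nonneg (by linarith), one_mul] at h1
    exact h1
  obtain ⟨X0, hX0⟩ := Filter.eventually_atTop.1 hlarge
  refine ⟨4097, by norm_num, X0, fun X hX Y0 Y hY0 hY _ hYX b W hb hWX _ v hv0 => ?_⟩
  obtain ⟨hlog8, hlog1, hX16⟩ := hX0 X hX
  set L := Real.log X with hL
  have hWpos : 0 < W := (Nat.zero_le b).trans_lt hb
  have hW' : (0 : ℝ) < W := by exact_mod_cast hWpos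
  have hφ : (0 : ℝ) < W.totient := by exact_mod_cast Nat.totient_pos.2 hWpos
  have hφL : (W.totient : ℝ) ≤ L := (Nat.cast_le.2 (Nat.totient_le W)).trans hWX
  have hρ := one_le_rhoZ (W * v)
  by_cases hv : (2 : ℤ) ∣ W * v
  swap
  · rw [twinCount_eq_zero_of_odd (by linarith) hv]
    push_cast
    positivity
  have hXpos : 0 < X := by linarith
  have hs16 : Real.sqrt X = (X ^ (1 / 32 : ℝ)) ^ 16 := by
    rw [Real.sqrt_eq_rpow, ← Real.rpow_natCast, ← Real.rpow_mul hXpos.le]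
    norm_num
  have hs1 : 1 ≤ X ^ (1 / 32 : ℝ) := Real.one_le_rpow (by linarith) (by norm_num)
  have hL4 : L ^ 4 ≤ Real.sqrt X := Real.le_sqrt_of_sq_le (by rw [← pow_mul]; exact hlog8)
  have hsqrt := Real.mul_self_sqrt hXpos.le
  have hsqrt4 : 4 ≤ Real.sqrt X := Real.le_sqrt_of_sq_le (by linarith)
  set y := ⌊X ^ (1 / 32 : ℝ)⌋₊ with hy
  have hy1 : 1 ≤ y := Nat.le_floor (by exact_mod_cast hs1)
  have hy16 : (y : ℝ) ^ 16 ≤ Real.sqrt X := by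
    rw [hs16]
    exact pow_le_pow_left₀ (by positivity) (Nat.floor_le (by positivity)) 16
  have hylog : L / 32 ≤ Real.log (y + 1) := by
    have h1 : Real.log (X ^ (1 / 32 : ℝ)) = L / 32 := by rw [Real.log_rpow hXpos]; ring
    rw [← h1]
    exact Real.log_le_log (by positivity) (Nat.lt_floor_add_one _).le
  have hy2 : ((y ^ 2 : ℕ) : ℝ) ≤ Y0 := by
    have h1 : (y : ℝ) ^ 2 ≤ (y : ℝ) ^ 16 :=
      pow_le_pow_right₀ (by exact_mod_cast hy1) (by norm_num)
    push_cast
    nlinarith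
  have hWY : W ≤ Y := by
    have h1 : L ≤ X / L := by
      rw [le_div_iff₀ (by linarith)]
      have h2 : L ^ 2 ≤ L ^ 8 := pow_le_pow_right₀ hlog1 (by norm_num)
      nlinarith
    linarith
  have hN : ((⌊Y / W⌋₊ + 1 : ℕ) : ℝ) * W ≤ 2 * Y := by
    have h1 := Nat.floor_le (a := Y / W) (by positivity)
    rw [le_div_iff₀ hW'] at h1
    push_cast
    linarith
  have hcount : (TwinCount b W Y0 Y v ⌊X⌋₊ : ℝ) ≤ _ :=
    (Nat.cast_le.2 (twinCount_le_card_coprime hb hy2)).trans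
      (card_coprime_pairProd_le (b := b) hWpos.ne' hv0 hv _ _ hy1)
  refine hcount.trans ?_
  have hmain : 2 * ((⌊Y / W⌋₊ + 1 : ℕ) : ℝ) * W * rhoZ (W * v) /
      (W.totient * Real.log (y + 1) ^ 2) ≤
      4096 * (Y / (W.totient * L ^ 2)) * rhoZ (W * v) := by
    calc _ = 2 * (((⌊Y / W⌋₊ + 1 : ℕ) : ℝ) * W) * rhoZ (W * v) /
          (W.totient * Real.log (y + 1) ^ 2) := by ring
      _ ≤ 2 * (2 * Y) * rhoZ (W * v) / (W.totient * (L / 32) ^ 2) := by gcongr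
      _ = _ := by field_simp; norm_num
  have herr : (y : ℝ) ^ 16 ≤ Y / (W.totient * L ^ 2) * rhoZ (W * v) := by
    refine hy16.trans (le_trans ?_ (le_mul_of_one_le_right (by positivity) hρ))
    rw [le_div_iff₀ (by positivity)]
    have h1 : X / L ≤ Y := hYX.le
    refine le_trans ?_ h1
    rw [le_div_iff₀ (by linarith)]
    calc Real.sqrt X * (W.totient * L ^ 2) * L ≤ Real.sqrt X * (L * L ^ 2) * L := by gcongr
      _ = Real.sqrt X * L ^ 4 := by ring
      _ ≤ Real.sqrt X * Real.sqrt X := by gcongr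
      _ = X := hsqrt
  linarith
end
end

section
/- Let M₀ = (m_{i,j})_{1≤i,j≤5} be a 5×5 integer matrix of rank 5 and for y ∈ ℤ⁵ set h_i(y) = ∑_{j=1}^5 m_{i,j} y_j (1 ≤ i ≤ 5). Then there is a constant C, depending only on M₀, such that for all sufficiently large X, every 0 < Y ≤ X, every positive integer q, all integers c₁,…,c₅, and all reals H₁,…,H₅ with H_i ≥ q log X for every i, one has ℋ ≤ C · H₁H₂H₃H₄H₅ · q^{−5} τ(q), where ℋ = ∑ ρ(v₁)⋯ρ(v₅), the sum taken over all v = (v₁,…,v₅) ∈ ℤ⁵ with 0 < |v_j| < Y, H_j < |h_j(v)| ≤ 2H_j and h_j(v) ≡ c_j (mod q) for every 1 ≤ j ≤ 5. -/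
open scoped BigOperators

noncomputable section

attribute [local instance] Classical.propDecidable

/-- The linear forms `h_i(v) = ∑_l m_{i,l} v_l` attached to a `5 × 5` integer matrix. -/
def hval (M0 : Matrix (Fin 5) (Fin 5) ℤ) (j : Fin 5) (v : Fin 5 → ℤ) : ℤ :=
  ∑ l, M0 j l * v l

/-- The quantity `ℋ = ∑ ρ(v₁)⋯ρ(v₅)`, summed over `v ∈ ℤ⁵` with `0 < |v_j| < Y`,
`H_j < |h_j(v)| ≤ 2 H_j` and `h_j(v) ≡ c_j (mod q)` for every `j`. -/
def Hcal (M0 : Matrix (Fin 5) (Fin 5) ℤ) (Y : ℝ) (q : ℕ) (c : Fin 5 → ℤ)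
    (H : Fin 5 → ℝ) : ℝ :=
  ∑' v : Fin 5 → ℤ,
    if ∀ j, v j ≠ 0 ∧ |(v j : ℝ)| < Y ∧ H j < |(hval M0 j v : ℝ)| ∧
        |(hval M0 j v : ℝ)| ≤ 2 * H j ∧ hval M0 j v ≡ c j [ZMOD (q : ℤ)] then
      ∏ j, rhoZ (v j)
    else 0

/-- Chebyshev's bound on a dyadic block of primes. -/
lemma prod_primes_Ioc_half_le (N : ℕ) (hN : Real.exp 186 ≤ (N / 2 : ℕ)) :
    ∏ p ∈ (Nat.primesLE N).filter (fun p => N / 2 < p), (1 + 31 / (p : ℝ)) ≤ 2 := by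
  set m := N / 2 with hm
  have hmpos : (0 : ℝ) < m := (Real.exp_pos _).trans_le hN
  have hlog : 186 ≤ Real.log m := (Real.le_log_iff_exp_le hmpos).2 hN
  have hNm : (N : ℝ) ≤ 3 * m := by
    have hm1 : 1 ≤ m := by exact_mod_cast hmpos
    have : N ≤ 3 * m := by omega
    exact_mod_cast this
  have hterm : ∀ p ∈ (Nat.primesLE N).filter (fun p => m < p),
      31 / (p : ℝ) ≤ 31 / (m * 186) * Real.log p := by
    intro p hp
    have hmp : (m : ℝ) ≤ p := by exact_mod_cast (Finset.mem_filter.1 hp).2.le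
    have hlp : 186 ≤ Real.log p := hlog.trans (Real.log_le_log hmpos hmp)
    calc 31 / (p : ℝ) ≤ 31 / m := by gcongr
      _ = 31 / (m * 186) * 186 := by field_simp
      _ ≤ 31 / (m * 186) * Real.log p := by gcongr
  have hsum : ∑ p ∈ (Nat.primesLE N).filter (fun p => m < p), 31 / (p : ℝ) ≤ Real.log 2 := by
    calc _ ≤ ∑ p ∈ (Nat.primesLE N).filter (fun p => m < p),
          31 / (m * 186) * Real.log p := Finset.sum_le_sum hterm
      _ ≤ ∑ p ∈ Nat.primesLE N, 31 / (m * 186) * Real.log p :=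
          Finset.sum_le_sum_of_subset_of_nonneg (Finset.filter_subset _ _)
            fun p _ _ => by positivity
      _ = 31 / (m * 186) * Chebyshev.theta N := by
          rw [← Finset.mul_sum, Chebyshev.theta_eq_sum_primesLE_log]
      _ ≤ 31 / (m * 186) * (Real.log 4 * (3 * m)) := by
          gcongr
          exact (Chebyshev.theta_le_log4_mul_x (Nat.cast_nonneg N)).trans (by gcongr)
      _ = Real.log 4 / 2 := by field_simp; norm_num
      _ = Real.log 2 := by
          rw [show (4 : ℝ) = 2 ^ 2 by norm_num, Real.log_pow]; push_cast; ring
  calc _ ≤ Real.exp (∑ p ∈ (Nat.primesLE N).filter (fun p => m < p), 31 / (p : ℝ)) :=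
        Real.prod_one_add_le_exp_sum _ fun p => by positivity
    _ ≤ Real.exp (Real.log 2) := Real.exp_le_exp.2 hsum
    _ = 2 := Real.exp_log (by norm_num)

lemma exists_prod_primesLE_le_mul :
    ∃ C > (0 : ℝ), ∀ N : ℕ, 1 ≤ N → ∏ p ∈ Nat.primesLE N, (1 + 31 / (p : ℝ)) ≤ C * N := by
  have hone : ∀ p : ℕ, 1 ≤ 1 + 31 / (p : ℝ) := fun p => by
    have : 0 ≤ 31 / (p : ℝ) := by positivity
    linarith
  set N₀ := 2 * (⌈Real.exp 186⌉₊ + 1) with hN₀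
  refine ⟨∏ p ∈ Nat.primesLE N₀, (1 + 31 / (p : ℝ)),
    Finset.prod_pos fun p _ => by linarith [hone p], fun N => ?_⟩
  induction N using Nat.strong_induction_on with
  | _ N ih =>
    intro hN
    rcases le_total N N₀ with h | h
    · have h1 : ∏ p ∈ Nat.primesLE N, (1 + 31 / (p : ℝ))
          ≤ ∏ p ∈ Nat.primesLE N₀, (1 + 31 / (p : ℝ)) := by
        refine Finset.prod_mono_set_of_one_le hone fun p hp => ?_
        rw [Nat.mem_primesLE] at hp ⊢
        exact ⟨hp.1.trans h, hp.2⟩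
      have h2 : (1 : ℝ) ≤ N := by exact_mod_cast hN
      refine h1.trans (le_mul_of_one_le_right (Finset.prod_nonneg fun p _ => ?_) h2)
      linarith [hone p]
    · have hm : Real.exp 186 ≤ (N / 2 : ℕ) := by
        refine (Nat.le_ceil _).trans ?_
        exact_mod_cast (show ⌈Real.exp 186⌉₊ ≤ N / 2 by omega)
      have hsplit := Finset.prod_filter_mul_prod_filter_not (Nat.primesLE N)
        (fun p => N / 2 < p) (fun p => 1 + 31 / (p : ℝ))
      have hlow : (Nat.primesLE N).filter (fun p => ¬ N / 2 < p) = Nat.primesLE (N / 2) := by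
        ext p
        simp only [Finset.mem_filter, Nat.mem_primesLE]
        constructor
        · rintro ⟨h1, h2⟩; exact ⟨not_lt.1 h2, h1.2⟩
        · rintro ⟨h1, h2⟩; exact ⟨⟨by omega, h2⟩, by omega⟩
      rw [hlow] at hsplit
      rw [← hsplit]
      have hhalf : ((N / 2 : ℕ) : ℝ) * 2 ≤ N := by
        exact_mod_cast Nat.div_mul_le_self N 2
      have hC : 0 ≤ ∏ p ∈ Nat.primesLE N₀, (1 + 31 / (p : ℝ)) :=
        Finset.prod_nonneg fun p _ => by linarith [hone p]
      calc _ ≤ 2 * ((∏ p ∈ Nat.primesLE N₀, (1 + 31 / (p : ℝ))) * (N / 2 : ℕ)) := by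
            gcongr
            · exact prod_primes_Ioc_half_le N hm
            · exact ih _ (by omega) (by omega)
        _ = (∏ p ∈ Nat.primesLE N₀, (1 + 31 / (p : ℝ))) * ((N / 2 : ℕ) * 2) := by ring
        _ ≤ _ := by gcongr

lemma prod_one_add_div_sq_le (s : Finset ℕ) :
    ∏ p ∈ s, (1 + 31 / (p : ℝ) ^ 2) ≤ Real.exp (31 * ∑' n : ℕ, 1 / (n : ℝ) ^ 2) := by
  have hs : Summable fun n : ℕ => 1 / (n : ℝ) ^ 2 := Real.summable_one_div_nat_pow.2 one_lt_two
  refine (Real.prod_one_add_le_exp_sum s fun p => by positivity).trans (Real.exp_le_exp.2 ?_)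
  calc ∑ p ∈ s, 31 / (p : ℝ) ^ 2 = 31 * ∑ p ∈ s, 1 / (p : ℝ) ^ 2 := by
        rw [Finset.mul_sum]; exact Finset.sum_congr rfl fun p _ => by ring
    _ ≤ _ := by
        gcongr
        exact hs.sum_le_tsum s fun n _ => by positivity

lemma one_add_pow_five_le {x : ℝ} (h0 : 0 ≤ x) (h1 : x ≤ 1) : (1 + x) ^ 5 ≤ 1 + 31 * x := by
  have h2 : x ^ 2 ≤ x := pow_le_of_le_one h0 h1 (by norm_num)
  have h3 : x ^ 3 ≤ x := pow_le_of_le_one h0 h1 (by norm_num)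
  have h4 : x ^ 4 ≤ x := pow_le_of_le_one h0 h1 (by norm_num)
  have h5 : x ^ 5 ≤ x := pow_le_of_le_one h0 h1 (by norm_num)
  nlinarith

lemma two_pow_card_primeFactors_le_card_divisors {n : ℕ} (hn : n ≠ 0) :
    2 ^ n.primeFactors.card ≤ n.divisors.card := by
  rw [Nat.card_divisors hn, ← Finset.prod_const]
  refine Finset.prod_le_prod' fun p hp => ?_
  have := (Nat.prime_of_mem_primeFactors hp).factorization_pos_of_dvd hn
    (Nat.dvd_of_mem_primeFactors hp)
  omega

lemma prod_primeFactors_pow_five_le_card_divisors {n : ℕ} (hn : n ≠ 0) :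
    ∏ p ∈ n.primeFactors, (1 + 1 / (p : ℝ)) ^ 5 ≤ 16 ^ 7 * (n.divisors.card : ℝ) := by
  calc ∏ p ∈ n.primeFactors, (1 + 1 / (p : ℝ)) ^ 5
      ≤ ∏ p ∈ n.primeFactors, ((if p < 7 then 16 else 1) * 2 : ℝ) := by
        refine Finset.prod_le_prod (fun p _ => by positivity) fun p hp => ?_
        have hp1 : (1 : ℝ) ≤ p := by
          exact_mod_cast (Nat.prime_of_mem_primeFactors hp).one_lt.le
        split_ifs with h
        · have : 1 / (p : ℝ) ≤ 1 := by rw [div_le_one (by linarith)]; exact hp1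
          calc (1 + 1 / (p : ℝ)) ^ 5 ≤ (1 + 1) ^ 5 := by gcongr
            _ = 16 * 2 := by norm_num
        · have hp7 : (7 : ℝ) ≤ p := by exact_mod_cast not_lt.1 h
          calc (1 + 1 / (p : ℝ)) ^ 5 ≤ (1 + 1 / 7) ^ 5 := by gcongr
            _ ≤ 1 * 2 := by norm_num
    _ = 16 ^ (n.primeFactors.filter (fun p => p < 7)).card * 2 ^ n.primeFactors.card := by
        rw [Finset.prod_mul_distrib, Finset.prod_const, ← Finset.prod_filter, Finset.prod_const]
    _ ≤ 16 ^ 7 * (n.divisors.card : ℝ) := by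
        gcongr
        · norm_num
        · calc _ ≤ (Finset.range 7).card :=
                Finset.card_le_card fun p hp => by simpa using (Finset.mem_filter.1 hp).2
            _ = 7 := Finset.card_range 7
        · exact_mod_cast two_pow_card_primeFactors_le_card_divisors hn

lemma two_pow_card_primeFactors_le {n : ℕ} (hn : n ≠ 0) : 2 ^ n.primeFactors.card ≤ n :=
  (two_pow_card_primeFactors_le_card_divisors hn).trans n.card_divisors_le_self

lemma prod_large_primeFactors_pow_five_le {n : ℕ} (hn : n ≠ 0) {X : ℝ} (hX : 1 ≤ Real.log X)
    (hnX : (n : ℝ) ≤ X) :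
    ∏ p ∈ n.primeFactors.filter (fun p : ℕ => Real.log X < p), (1 + 1 / (p : ℝ)) ^ 5
      ≤ Real.exp (5 / Real.log 2) := by
  have hn0 : (0 : ℝ) < n := by exact_mod_cast Nat.pos_of_ne_zero hn
  have hl2 : 0 < Real.log 2 := Real.log_pos one_lt_two
  have hω : (n.primeFactors.card : ℝ) * Real.log 2 ≤ Real.log X := by
    rw [← Real.log_pow]
    refine Real.log_le_log (by positivity) (le_trans ?_ hnX)
    exact_mod_cast two_pow_card_primeFactors_le hn
  rw [Finset.prod_pow]
  calc _ ≤ (Real.exp (∑ p ∈ n.primeFactors.filter (fun p : ℕ => Real.log X < p),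
          1 / (p : ℝ))) ^ 5 := by
        gcongr
        exact Real.prod_one_add_le_exp_sum _ fun p => by positivity
    _ ≤ (Real.exp (1 / Real.log 2)) ^ 5 := by
        gcongr
        calc _ ≤ ∑ p ∈ n.primeFactors.filter (fun p : ℕ => Real.log X < p), 1 / Real.log X := by
              refine Finset.sum_le_sum fun p hp => ?_
              have := (Finset.mem_filter.1 hp).2
              gcongr
          _ = ((n.primeFactors.filter (fun p : ℕ => Real.log X < p)).card : ℝ)
                * (1 / Real.log X) := by simp
          _ ≤ (n.primeFactors.card : ℝ) * (1 / Real.log X) := by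
              gcongr
              exact Finset.filter_subset _ _
          _ ≤ 1 / Real.log 2 := by
              rw [mul_one_div, div_le_div_iff₀ (by linarith) hl2]
              linarith
    _ = Real.exp (5 / Real.log 2) := by
        rw [← Real.exp_nat_mul]; congr 1; push_cast; ring

/-- The primes up to `z` dividing neither `a` nor `q`. -/
def sievePrimes (a q : ℕ) (z : ℝ) : Finset ℕ :=
  (Nat.primesLE ⌊z⌋₊).filter fun p => ¬ p ∣ a ∧ ¬ p ∣ q

lemma rhoZ_pow_five_le {a q : ℕ} (ha : a ≠ 0) (hq : q ≠ 0) {v : ℤ} (hv : v ≠ 0) {X : ℝ}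
    (hX : 1 ≤ Real.log X) (hvX : |(v : ℝ)| ≤ X) :
    rhoZ v ^ 5 ≤ Real.exp (5 / Real.log 2) * (∏ p ∈ a.primeFactors, (1 + 1 / (p : ℝ)) ^ 5)
      * (16 ^ 7 * (q.divisors.card : ℝ))
      * ∏ p ∈ (sievePrimes a q (Real.log X)).filter (fun p : ℕ => (p : ℤ) ∣ v),
          (1 + 31 / (p : ℝ)) := by
  have hn : v.natAbs ≠ 0 := Int.natAbs_ne_zero.2 hv
  have hnX : (v.natAbs : ℝ) ≤ X := by rwa [Nat.cast_natAbs, Int.cast_abs]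
  set g : ℕ → ℝ := fun p => (1 + 1 / (p : ℝ)) ^ 5 with hg
  have hg1 : ∀ p, 1 ≤ g p := fun p => one_le_pow₀ (by
    have : 0 ≤ 1 / (p : ℝ) := by positivity
    linarith)
  have hg0 : ∀ p, 0 ≤ g p := fun p => zero_le_one.trans (hg1 p)
  set S := v.natAbs.primeFactors with hS
  have hpt : ∀ p ∈ S, g p ≤ (if Real.log X < p then g p else 1) * (if p ∣ a then g p else 1)
      * (if p ∣ q then g p else 1)
      * (if p ∈ sievePrimes a q (Real.log X) then g p else 1) := by
    intro p hp
    have hx : ∀ (P : Prop) [Decidable P], 1 ≤ if P then g p else 1 := fun P _ => by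
      split_ifs
      exacts [hg1 p, le_rfl]
    by_cases h1 : Real.log X < p
    · rw [if_pos h1]
      exact le_mul_of_one_le_right (by positivity) (hx _) |>.trans' <|
        le_mul_of_one_le_right (by positivity) (hx _) |>.trans' <|
        le_mul_of_one_le_right (hg0 p) (hx _)
    by_cases h2 : p ∣ a
    · rw [if_neg h1, if_pos h2, one_mul]
      exact le_mul_of_one_le_right (by positivity) (hx _) |>.trans' <|
        le_mul_of_one_le_right (hg0 p) (hx _)
    by_cases h3 : p ∣ q
    · rw [if_neg h1, if_neg h2, if_pos h3, one_mul, one_mul]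
      exact le_mul_of_one_le_right (hg0 p) (hx _)
    · have h4 : p ∈ sievePrimes a q (Real.log X) := by
        simp only [sievePrimes, Finset.mem_filter, Nat.mem_primesLE]
        exact ⟨⟨Nat.le_floor (not_lt.1 h1), Nat.prime_of_mem_primeFactors hp⟩, h2, h3⟩
      rw [if_neg h1, if_neg h2, if_neg h3, if_pos h4, one_mul, one_mul, one_mul]
  have hsub : ∀ b : ℕ, b ≠ 0 → ∏ p ∈ S.filter (fun p => p ∣ b), g p
      ≤ ∏ p ∈ b.primeFactors, g p := by
    intro b hb
    refine Finset.prod_mono_set_of_one_le hg1 ?_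
    intro p hp
    rw [Finset.mem_filter] at hp
    exact Nat.mem_primeFactors.2 ⟨Nat.prime_of_mem_primeFactors hp.1, hp.2, hb⟩
  calc rhoZ v ^ 5 = ∏ p ∈ S, g p := by rw [rhoZ, Finset.prod_pow]
    _ ≤ _ := Finset.prod_le_prod (fun p _ => hg0 p) hpt
    _ = (∏ p ∈ S.filter (fun p : ℕ => Real.log X < p), g p)
        * (∏ p ∈ S.filter (fun p => p ∣ a), g p) * (∏ p ∈ S.filter (fun p => p ∣ q), g p)
        * (∏ p ∈ S.filter (fun p => p ∈ sievePrimes a q (Real.log X)), g p) := by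
      simp only [Finset.prod_mul_distrib, Finset.prod_filter]
    _ ≤ _ := by
      have hp0 : ∀ s : Finset ℕ, 0 ≤ ∏ p ∈ s, g p := fun s => Finset.prod_nonneg fun p _ => hg0 p
      have hlarge := prod_large_primeFactors_pow_five_le hn hX hnX
      have hdvd_q := (hsub q hq).trans (prod_primeFactors_pow_five_le_card_divisors hq)
      refine mul_le_mul (mul_le_mul (mul_le_mul hlarge (hsub a ha) (hp0 _) (by positivity))
        hdvd_q (hp0 _) (by positivity)) ?_ (hp0 _) (by positivity)
      have heq : S.filter (fun p => p ∈ sievePrimes a q (Real.log X))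
          = (sievePrimes a q (Real.log X)).filter (fun p : ℕ => (p : ℤ) ∣ v) := by
        ext p
        simp only [Finset.mem_filter, hS, Nat.mem_primeFactors, Int.natCast_dvd]
        refine ⟨fun h => ⟨h.2, h.1.2.1⟩, fun h => ⟨⟨?_, h.2, hn⟩, h.1⟩⟩
        exact (Nat.mem_primesLE.1 (Finset.mem_filter.1 h.1).1).2
      rw [heq]
      refine Finset.prod_le_prod (fun p _ => hg0 p) fun p hp => ?_
      have hp1 : (1 : ℝ) ≤ p := by
        have := (Nat.mem_primesLE.1
          (Finset.mem_filter.1 (Finset.mem_filter.1 hp).1).1).2.one_lt.le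
        exact_mod_cast this
      rw [show 31 / (p : ℝ) = 31 * (1 / p) by ring]
      exact one_add_pow_five_le (by positivity) (by rw [div_le_one (by linarith)]; exact hp1)

lemma card_le_of_dvd_sub_of_sub_le {U : Finset ℤ} {m : ℕ} (hm : 0 < m) {H : ℝ} (hH : 0 ≤ H)
    (hdvd : ∀ u ∈ U, ∀ w ∈ U, (m : ℤ) ∣ u - w) (hlen : ∀ u ∈ U, ∀ w ∈ U, ((u - w : ℤ) : ℝ) ≤ H) :
    (U.card : ℝ) ≤ H / m + 1 := by
  have hm0 : (0 : ℝ) < m := by exact_mod_cast hm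
  rcases U.eq_empty_or_nonempty with rfl | hU
  · simp only [Finset.card_empty, Nat.cast_zero]
    positivity
  set u₀ := U.min' hU with hu₀
  have hmem : u₀ ∈ U := U.min'_mem hU
  have hcard : U.card ≤ (Finset.range (⌊H / m⌋₊ + 1)).card := by
    refine Finset.card_le_card_of_injOn (fun u => ((u - u₀) / m).toNat) ?_ ?_
    · intro u hu
      obtain ⟨k, hk⟩ := hdvd u hu u₀ hmem
      have hlen' := hlen u hu u₀ hmem
      have hmz : (m : ℤ) ≠ 0 := by exact_mod_cast hm.ne'
      have hnn : 0 ≤ u - u₀ := sub_nonneg.2 (U.min'_le u hu)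
      have hk0 : 0 ≤ k := by
        by_contra! h
        nlinarith [show (0 : ℤ) < m by exact_mod_cast hm]
      simp only [Finset.coe_range, Set.mem_Iio, hk, Int.mul_ediv_cancel_left _ hmz]
      lift k to ℕ using hk0
      rw [Int.toNat_natCast, Nat.lt_succ_iff]
      refine Nat.le_floor ?_
      rw [le_div_iff₀ hm0]
      rw [hk] at hlen'
      push_cast at hlen'
      linarith
    · intro u hu w hw huw
      have h1 := Int.ediv_mul_cancel (hdvd u hu u₀ hmem)
      have h2 := Int.ediv_mul_cancel (hdvd w hw u₀ hmem)
      have h3 : 0 ≤ (u - u₀) / m :=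
        Int.ediv_nonneg (sub_nonneg.2 (U.min'_le u hu)) (Int.natCast_nonneg m)
      have h4 : 0 ≤ (w - u₀) / m :=
        Int.ediv_nonneg (sub_nonneg.2 (U.min'_le w hw)) (Int.natCast_nonneg m)
      have h5 : (u - u₀) / m = (w - u₀) / m := by
        simp only at huw
        omega
      rw [h5] at h1
      linarith
  calc (U.card : ℝ) ≤ (⌊H / m⌋₊ + 1 : ℕ) := by
        rw [Finset.card_range] at hcard
        exact_mod_cast hcard
    _ ≤ H / m + 1 := by
        push_cast
        gcongr
        exact Nat.floor_le (by positivity)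

/-- Integers in one residue class modulo `m` with absolute value in `(H, 2 * H]`. -/
lemma card_le_of_dyadic {U : Finset ℤ} {m : ℕ} (hm : 0 < m) {H : ℝ} (hH : 0 ≤ H)
    (hdvd : ∀ u ∈ U, ∀ w ∈ U, (m : ℤ) ∣ u - w)
    (hU : ∀ u ∈ U, H < |(u : ℝ)| ∧ |(u : ℝ)| ≤ 2 * H) :
    (U.card : ℝ) ≤ 2 * (H / m + 1) := by
  have hpos : ((U.filter (fun u => 0 < u)).card : ℝ) ≤ H / m + 1 := by
    refine card_le_of_dvd_sub_of_sub_le hm hH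
      (fun u hu w hw => hdvd u (Finset.mem_filter.1 hu).1 w (Finset.mem_filter.1 hw).1) ?_
    intro u hu w hw
    rw [Finset.mem_filter] at hu hw
    have hu0 : (0 : ℝ) < u := by exact_mod_cast hu.2
    have hw0 : (0 : ℝ) < w := by exact_mod_cast hw.2
    have h1 := hU u hu.1
    have h2 := hU w hw.1
    rw [abs_of_pos hu0] at h1
    rw [abs_of_pos hw0] at h2
    push_cast
    linarith
  have hneg : ((U.filter (fun u => ¬ 0 < u)).card : ℝ) ≤ H / m + 1 := by
    refine card_le_of_dvd_sub_of_sub_le hm hH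
      (fun u hu w hw => hdvd u (Finset.mem_filter.1 hu).1 w (Finset.mem_filter.1 hw).1) ?_
    intro u hu w hw
    rw [Finset.mem_filter] at hu hw
    have hu0 : (u : ℝ) ≤ 0 := by exact_mod_cast not_lt.1 hu.2
    have hw0 : (w : ℝ) ≤ 0 := by exact_mod_cast not_lt.1 hw.2
    have h1 := hU u hu.1
    have h2 := hU w hw.1
    rw [abs_of_nonpos hu0] at h1
    rw [abs_of_nonpos hw0] at h2
    push_cast
    linarith
  rw [← Finset.card_filter_add_card_filter_not (s := U) (fun u => 0 < u)]
  push_cast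
  linarith

/-- A finite set of functions is bounded by a bound for its fibres in direction `j` times bounds
for its projections in the other directions. -/
lemma card_le_of_fiber_le {ι : Type*} [Fintype ι] [DecidableEq ι] (j : ι)
    (T : Finset (ι → ℤ)) (K : ℝ) (B : ι → ℝ)
    (hB : ∀ k, k ≠ j → ((T.image (fun h => h k)).card : ℝ) ≤ B k)
    (hK : ∀ g ∈ T, ((T.filter (fun h => ∀ k, k ≠ j → h k = g k)).card : ℝ) ≤ K) (hK0 : 0 ≤ K) :
    (T.card : ℝ) ≤ K * ∏ k ∈ Finset.univ.erase j, B k := by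
  set f : (ι → ℤ) → (ι → ℤ) := fun h => Function.update h j 0 with hf
  have hfib : ∀ b ∈ T.image f, (T.filter (fun h => f h = b)).card ≤ ⌊K⌋₊ := by
    intro b hb
    obtain ⟨g, hg, rfl⟩ := Finset.mem_image.1 hb
    refine Nat.le_floor (le_trans ?_ (hK g hg))
    exact_mod_cast Finset.card_le_card fun h hh => by
      rw [Finset.mem_filter] at hh ⊢
      refine ⟨hh.1, fun k hk => ?_⟩
      have := congrFun hh.2 k
      simpa [hf, Function.update_of_ne hk] using this
  have himg : ((T.image f).card : ℝ) ≤ ∏ k ∈ Finset.univ.erase j, B k := by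
    have hsub : T.image f ⊆
        Fintype.piFinset fun k => if k = j then {0} else T.image (fun h => h k) := by
      intro b hb
      obtain ⟨g, hg, rfl⟩ := Finset.mem_image.1 hb
      rw [Fintype.mem_piFinset]
      intro k
      by_cases hk : k = j
      · subst hk; simp [hf]
      · simp only [if_neg hk, hf, Function.update_of_ne hk]
        exact Finset.mem_image_of_mem (fun h : ι → ℤ => h k) hg
    calc ((T.image f).card : ℝ)
        ≤ ((Fintype.piFinset fun k =>
            if k = j then {0} else T.image (fun h => h k)).card : ℝ) := by
          exact_mod_cast Finset.card_le_card hsub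
      _ = ∏ k ∈ Finset.univ.erase j, ((T.image (fun h => h k)).card : ℝ) := by
          rw [Fintype.card_piFinset, ← Finset.mul_prod_erase _ _ (Finset.mem_univ j)]
          push_cast
          rw [if_pos rfl, Finset.card_singleton, Nat.cast_one, one_mul]
          refine Finset.prod_congr rfl fun k hk => ?_
          rw [if_neg (Finset.ne_of_mem_erase hk)]
      _ ≤ _ := Finset.prod_le_prod (fun k _ => Nat.cast_nonneg _)
          fun k hk => hB k (Finset.ne_of_mem_erase hk)
  calc (T.card : ℝ) ≤ ((⌊K⌋₊ * (T.image f).card : ℕ) : ℝ) := by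
        exact_mod_cast Finset.card_le_mul_card_image T _ hfib
    _ ≤ K * ∏ k ∈ Finset.univ.erase j, B k := by
        push_cast
        exact mul_le_mul (Nat.floor_le hK0) himg (Nat.cast_nonneg _) hK0

lemma det_mul_eq_sum_adjugate (M0 : Matrix (Fin 5) (Fin 5) ℤ) (v : Fin 5 → ℤ) (i : Fin 5) :
    M0.det * v i = ∑ k, M0.adjugate i k * hval M0 k v := by
  have h : (M0.adjugate * M0).mulVec v i = M0.det * v i := by
    rw [Matrix.adjugate_mul, Matrix.smul_mulVec, Matrix.one_mulVec]
    rfl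
  rw [← h, ← Matrix.mulVec_mulVec]
  rfl

lemma hval_injective {M0 : Matrix (Fin 5) (Fin 5) ℤ} (hdet : M0.det ≠ 0) {v w : Fin 5 → ℤ}
    (h : ∀ k, hval M0 k v = hval M0 k w) : v = w := by
  funext i
  refine mul_left_cancel₀ hdet ?_
  rw [det_mul_eq_sum_adjugate, det_mul_eq_sum_adjugate]
  exact Finset.sum_congr rfl fun k _ => by rw [h k]

/-- The constraints on `v` imposed by the dyadic ranges and congruences of the forms `h_k`. -/
def InBox (M0 : Matrix (Fin 5) (Fin 5) ℤ) (q : ℕ) (c : Fin 5 → ℤ) (H : Fin 5 → ℝ)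
    (v : Fin 5 → ℤ) : Prop :=
  ∀ k, H k < |(hval M0 k v : ℝ)| ∧ |(hval M0 k v : ℝ)| ≤ 2 * H k ∧
    hval M0 k v ≡ c k [ZMOD (q : ℤ)]

lemma card_dvd_le {M0 : Matrix (Fin 5) (Fin 5) ℤ} (hdet : M0.det ≠ 0) {i j : Fin 5}
    {q : ℕ} (hq : 0 < q) {c : Fin 5 → ℤ} {H : Fin 5 → ℝ} {z : ℝ} (hz : 1 ≤ z)
    (hH : ∀ k, q * z ≤ H k) {d : ℕ} (hd : 0 < d) (hda : d.Coprime (M0.adjugate i j).natAbs)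
    (hdq : d.Coprime q) (S : Finset (Fin 5 → ℤ)) (hS : ∀ v ∈ S, InBox M0 q c H v)
    (hdvd : ∀ v ∈ S, (d : ℤ) ∣ v i) :
    (S.card : ℝ) ≤ 512 * (∏ k, H k) * ((q : ℝ) ^ 5)⁻¹ * (1 / d + 1 / z) := by
  have hq0 : (0 : ℝ) < q := by exact_mod_cast hq
  have hd0 : (0 : ℝ) < d := by exact_mod_cast hd
  have hz0 : 0 < z := by linarith
  have hqH : ∀ k, (q : ℝ) ≤ H k := fun k => (le_mul_of_one_le_right hq0.le hz).trans (hH k)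
  have hH0 : ∀ k, 0 < H k := fun k => hq0.trans_le (hqH k)
  set φ : (Fin 5 → ℤ) → (Fin 5 → ℤ) := fun v k => hval M0 k v with hφ
  have hinj : Function.Injective φ := fun v w h => hval_injective hdet fun k => congrFun h k
  have hbox : ∀ h ∈ S.image φ, ∀ k, H k < |(h k : ℝ)| ∧ |(h k : ℝ)| ≤ 2 * H k ∧
      h k ≡ c k [ZMOD (q : ℤ)] := by
    intro h hh k
    obtain ⟨v, hv, rfl⟩ := Finset.mem_image.1 hh
    exact hS v hv k
  have hmod : ∀ h ∈ S.image φ, ∀ g ∈ S.image φ, ∀ k, (q : ℤ) ∣ h k - g k := by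
    intro h hh g hg k
    exact ((hbox g hg k).2.2.trans (hbox h hh k).2.2.symm).dvd
  have hproj : ∀ k, k ≠ j →
      (((S.image φ).image (fun h => h k)).card : ℝ) ≤ 4 * (H k / q) := by
    intro k _
    have h1 : 1 ≤ H k / q := by rw [le_div_iff₀ hq0, one_mul]; exact hqH k
    refine (card_le_of_dyadic hq (hH0 k).le ?_ ?_).trans
      (by linarith : 2 * (H k / q + 1) ≤ 4 * (H k / q))
    · intro u hu w hw
      obtain ⟨h, hh, rfl⟩ := Finset.mem_image.1 hu
      obtain ⟨g, hg, rfl⟩ := Finset.mem_image.1 hw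
      exact hmod h hh g hg k
    · intro u hu
      obtain ⟨h, hh, rfl⟩ := Finset.mem_image.1 hu
      exact ⟨(hbox h hh k).1, (hbox h hh k).2.1⟩
  have hfiber : ∀ g ∈ S.image φ, (((S.image φ).filter
      (fun h => ∀ k, k ≠ j → h k = g k)).card : ℝ) ≤ 2 * (H j / (q * d : ℕ) + 1) := by
    intro g hg
    set F := (S.image φ).filter (fun h => ∀ k, k ≠ j → h k = g k) with hF
    have hFinj : Set.InjOn (fun h : Fin 5 → ℤ => h j) F := by
      intro h hh h' hh' hj
      funext k
      by_cases hk : k = j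
      · subst hk; exact hj
      · rw [(Finset.mem_filter.1 hh).2 k hk, (Finset.mem_filter.1 hh').2 k hk]
    rw [← Finset.card_image_of_injOn hFinj]
    refine card_le_of_dyadic (Nat.mul_pos hq hd) (hH0 j).le ?_ ?_
    · intro u hu w hw
      obtain ⟨h, hh, rfl⟩ := Finset.mem_image.1 hu
      obtain ⟨h', hh', rfl⟩ := Finset.mem_image.1 hw
      rw [Finset.mem_filter] at hh hh'
      push_cast
      refine IsCoprime.mul_dvd (Nat.isCoprime_iff_coprime.2 hdq.symm)
        (hmod h hh.1 h' hh'.1 j) ?_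
      obtain ⟨v, hv, rfl⟩ := Finset.mem_image.1 hh.1
      obtain ⟨v', hv', rfl⟩ := Finset.mem_image.1 hh'.1
      have hlin : M0.det * v i - M0.det * v' i = M0.adjugate i j * (φ v j - φ v' j) := by
        rw [det_mul_eq_sum_adjugate, det_mul_eq_sum_adjugate, ← Finset.sum_sub_distrib,
          Finset.sum_eq_single j]
        · rw [mul_sub]
        · intro k _ hk
          have := (hh.2 k hk).trans (hh'.2 k hk).symm
          simp only [hφ] at this
          rw [this, sub_self]
        · simp
      have hcop : IsCoprime (d : ℤ) (M0.adjugate i j) := by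
        rw [Int.isCoprime_iff_gcd_eq_one, Int.gcd, Int.natAbs_natCast]
        exact hda
      refine hcop.dvd_of_dvd_mul_left ?_
      rw [← hlin]
      exact dvd_sub ((hdvd v hv).mul_left _) ((hdvd v' hv').mul_left _)
    · intro u hu
      obtain ⟨h, hh, rfl⟩ := Finset.mem_image.1 hu
      have := hbox h (Finset.mem_filter.1 hh).1 j
      exact ⟨this.1, this.2.1⟩
  have hmain := card_le_of_fiber_le j (S.image φ) (2 * (H j / (q * d : ℕ) + 1))
    (fun k => 4 * (H k / q)) hproj
    (fun g hg => by convert hfiber g hg) (by have := (hH0 j).le; positivity)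
  rw [Finset.card_image_of_injective _ hinj] at hmain
  have hjz : 2 * (H j / (q * d : ℕ) + 1) ≤ 2 * (H j / q) * (1 / d + 1 / z) := by
    have h1 : 1 ≤ H j / q * (1 / z) := by
      rw [div_mul_div_comm, mul_one, le_div_iff₀ (by positivity), one_mul]
      exact hH j
    have h2 : H j / (q * d : ℕ) = H j / q * (1 / d) := by
      push_cast
      rw [div_mul_div_comm, mul_one]
    rw [h2]
    linarith
  have hprod0 : 0 ≤ ∏ k ∈ Finset.univ.erase j, 4 * (H k / q) :=
    Finset.prod_nonneg fun k _ => by have := (hH0 k).le; positivity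
  calc (S.card : ℝ) ≤ _ := hmain
    _ ≤ 2 * (H j / q) * (1 / d + 1 / z) * ∏ k ∈ Finset.univ.erase j, 4 * (H k / q) := by
        gcongr
    _ = (1 / d + 1 / z) / 2 * (4 * (H j / q) * ∏ k ∈ Finset.univ.erase j, 4 * (H k / q)) := by
        ring
    _ = (1 / d + 1 / z) / 2 * ∏ k, 4 * (H k / q) := by
        rw [Finset.mul_prod_erase _ (fun k => 4 * (H k / q)) (Finset.mem_univ j)]
    _ = _ := by
        rw [Finset.prod_mul_distrib, Finset.prod_div_distrib]
        simp only [Finset.prod_const, Finset.card_univ, Fintype.card_fin]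
        ring

lemma sum_rhoZ_pow_five_le {M0 : Matrix (Fin 5) (Fin 5) ℤ} (hdet : M0.det ≠ 0) {i j : Fin 5}
    (hij : M0.adjugate i j ≠ 0) :
    ∃ C > 0, ∀ X : ℝ, 1 ≤ Real.log X → ∀ q : ℕ, 0 < q → ∀ c : Fin 5 → ℤ, ∀ H : Fin 5 → ℝ,
      (∀ k, (q : ℝ) * Real.log X ≤ H k) → ∀ S : Finset (Fin 5 → ℤ),
      (∀ v ∈ S, InBox M0 q c H v) → (∀ v ∈ S, v i ≠ 0 ∧ |(v i : ℝ)| ≤ X) →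
      ∑ v ∈ S, rhoZ (v i) ^ 5 ≤
        C * (∏ k, H k) * ((q : ℝ) ^ 5)⁻¹ * (q.divisors.card : ℝ) := by
  obtain ⟨C₀, hC₀, hmertens⟩ := exists_prod_primesLE_le_mul
  set a := (M0.adjugate i j).natAbs with ha
  set E : ℝ := Real.exp (5 / Real.log 2) * ∏ p ∈ a.primeFactors, (1 + 1 / (p : ℝ)) ^ 5 with hE
  set Q : ℝ := Real.exp (31 * ∑' n : ℕ, 1 / (n : ℝ) ^ 2) with hQ
  have hE0 : 0 < E := mul_pos (Real.exp_pos _) (Finset.prod_pos fun p _ => by positivity)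
  refine ⟨E * 16 ^ 7 * 512 * (Q + C₀), by positivity, ?_⟩
  intro X hX q hq c H hH S hbox hS
  set z := Real.log X with hz
  have hz0 : 0 < z := by linarith
  have hq0 : (0 : ℝ) < q := by exact_mod_cast hq
  have hH0 : ∀ k, 0 ≤ H k := fun k => (by positivity : 0 ≤ (q : ℝ) * z).trans (hH k)
  set P := sievePrimes a q z with hP
  have hprime : ∀ p ∈ P, p.Prime := fun p hp =>
    (Nat.mem_primesLE.1 (Finset.mem_filter.1 hp).1).2
  set τ : ℝ := (q.divisors.card : ℝ) with hτ
  set V : ℝ := (∏ k, H k) * ((q : ℝ) ^ 5)⁻¹ with hV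
  have hV0 : 0 ≤ V := mul_nonneg (Finset.prod_nonneg fun k _ => hH0 k) (by positivity)
  set g : Finset ℕ → ℝ := fun T => ∏ p ∈ T, 31 / (p : ℝ) with hg
  have hg0 : ∀ T, 0 ≤ g T := fun T => Finset.prod_nonneg fun p _ => by positivity
  have hexpand : ∀ v ∈ S, ∏ p ∈ P.filter (fun p : ℕ => (p : ℤ) ∣ v i), (1 + 31 / (p : ℝ))
      ≤ ∑ T ∈ P.powerset, if ((∏ p ∈ T, p : ℕ) : ℤ) ∣ v i then g T else 0 := by
    intro v _
    rw [Finset.prod_one_add, ← Finset.sum_filter]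
    refine Finset.sum_le_sum_of_subset_of_nonneg ?_ fun T _ _ => hg0 T
    intro T hT
    rw [Finset.mem_powerset] at hT
    refine Finset.mem_filter.2 ⟨Finset.mem_powerset.2 (hT.trans (Finset.filter_subset _ _)), ?_⟩
    rw [Int.natCast_dvd]
    refine Finset.prod_primes_dvd _ (fun p hp => ?_) fun p hp => ?_
    · exact (hprime p (Finset.mem_filter.1 (hT hp)).1).prime
    · exact Int.natCast_dvd.1 (Finset.mem_filter.1 (hT hp)).2
  have hcount : ∀ T ∈ P.powerset,
      ((S.filter (fun v => ((∏ p ∈ T, p : ℕ) : ℤ) ∣ v i)).card : ℝ)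
        ≤ 512 * V * (1 / (∏ p ∈ T, p : ℕ) + 1 / z) := by
    intro T hT
    rw [Finset.mem_powerset] at hT
    rw [hV, ← mul_assoc]
    refine card_dvd_le hdet hq hX hH (Finset.prod_pos fun p hp => (hprime p (hT hp)).pos)
      (i := i) (j := j) (c := c) ?_ ?_ _
      (fun v hv => hbox v (Finset.mem_filter.1 hv).1) (fun v hv => (Finset.mem_filter.1 hv).2)
    · refine Nat.Coprime.prod_left fun p hp => ?_
      exact (hprime p (hT hp)).coprime_iff_not_dvd.2 (Finset.mem_filter.1 (hT hp)).2.1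
    · refine Nat.Coprime.prod_left fun p hp => ?_
      exact (hprime p (hT hp)).coprime_iff_not_dvd.2 (Finset.mem_filter.1 (hT hp)).2.2
  have hsq : ∑ T ∈ P.powerset, g T * (1 / (∏ p ∈ T, p : ℕ)) ≤ Q := by
    refine le_trans (le_of_eq ?_) (prod_one_add_div_sq_le P)
    rw [Finset.prod_one_add]
    refine Finset.sum_congr rfl fun T _ => ?_
    rw [hg, Nat.cast_prod, one_div, ← Finset.prod_inv_distrib, ← Finset.prod_mul_distrib]
    exact Finset.prod_congr rfl fun p _ => by rw [sq, ← div_eq_mul_inv, div_div]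
  have hlin : ∑ T ∈ P.powerset, g T * (1 / z) ≤ C₀ := by
    rw [← Finset.sum_mul, ← Finset.prod_one_add, mul_one_div, div_le_iff₀ hz0]
    calc ∏ p ∈ P, (1 + 31 / (p : ℝ)) ≤ ∏ p ∈ Nat.primesLE ⌊z⌋₊, (1 + 31 / (p : ℝ)) :=
          Finset.prod_mono_set_of_one_le
            (fun p : ℕ => le_add_of_nonneg_right (by positivity)) (Finset.filter_subset _ _)
      _ ≤ C₀ * ⌊z⌋₊ := hmertens _ ((Nat.one_le_floor_iff z).2 hX)
      _ ≤ C₀ * z := by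
          gcongr
          exact Nat.floor_le hz0.le
  calc ∑ v ∈ S, rhoZ (v i) ^ 5
      ≤ ∑ v ∈ S, E * (16 ^ 7 * τ)
          * ∑ T ∈ P.powerset, if ((∏ p ∈ T, p : ℕ) : ℤ) ∣ v i then g T else 0 := by
        refine Finset.sum_le_sum fun v hv => ?_
        refine (rhoZ_pow_five_le (Int.natAbs_ne_zero.2 hij) hq.ne' (hS v hv).1 hX
          (hS v hv).2).trans ?_
        exact mul_le_mul_of_nonneg_left (hexpand v hv) (by positivity)
    _ = E * (16 ^ 7 * τ) * ∑ T ∈ P.powerset,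
          g T * ((S.filter (fun v => ((∏ p ∈ T, p : ℕ) : ℤ) ∣ v i)).card : ℝ) := by
        rw [← Finset.mul_sum, Finset.sum_comm]
        congr 1
        refine Finset.sum_congr rfl fun T _ => ?_
        rw [← Finset.sum_filter, Finset.sum_const, nsmul_eq_mul, mul_comm]
    _ ≤ E * (16 ^ 7 * τ) * ∑ T ∈ P.powerset,
          g T * (512 * V * (1 / (∏ p ∈ T, p : ℕ) + 1 / z)) := by
        gcongr with T hT
        exact hcount T hT
    _ = E * (16 ^ 7 * τ) * (512 * V * (∑ T ∈ P.powerset, g T * (1 / (∏ p ∈ T, p : ℕ))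
          + ∑ T ∈ P.powerset, g T * (1 / z))) := by
        rw [← Finset.sum_add_distrib, Finset.mul_sum _ _ (512 * V)]
        congr 1
        exact Finset.sum_congr rfl fun T _ => by ring
    _ ≤ E * (16 ^ 7 * τ) * (512 * V * (Q + C₀)) := by
        gcongr
    _ = _ := by rw [hV]; ring

lemma prod_fin_five_le_sum_pow (x : Fin 5 → ℝ) (hx : ∀ i, 0 ≤ x i) :
    ∏ i, x i ≤ ∑ i, x i ^ 5 := by
  obtain ⟨m, -, hm⟩ := Finset.exists_max_image Finset.univ x Finset.univ_nonempty
  calc ∏ i, x i ≤ ∏ _i : Fin 5, x m :=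
        Finset.prod_le_prod (fun i _ => hx i) fun i hi => hm i hi
    _ = x m ^ 5 := by simp
    _ ≤ ∑ i, x i ^ 5 :=
        Finset.single_le_sum (fun i _ => pow_nonneg (hx i) 5) (Finset.mem_univ m)

lemma rhoZ_nonneg (v : ℤ) : 0 ≤ rhoZ v := Finset.prod_nonneg fun p _ => by positivity

lemma det_ne_zero_of_rank_eq_five {M0 : Matrix (Fin 5) (Fin 5) ℤ}
    (hrk : (M0.map (fun x : ℤ => (x : ℚ))).rank = 5) : M0.det ≠ 0 := by
  set A := M0.map (fun x : ℤ => (x : ℚ)) with hA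
  have hsurj : Function.Surjective A.mulVec := by
    have htop : LinearMap.range A.mulVecLin = ⊤ := by
      refine Submodule.eq_top_of_finrank_eq ?_
      rw [Module.finrank_fin_fun]
      exact hrk
    exact LinearMap.range_eq_top.1 htop
  have hunit : A.det ≠ 0 :=
    ((Matrix.isUnit_iff_isUnit_det A).1 (Matrix.mulVec_surjective_iff_isUnit.1 hsurj)).ne_zero
  intro h
  have hmap : (Int.castRingHom ℚ) M0.det = A.det := (Int.castRingHom ℚ).map_det M0
  rw [h, map_zero] at hmap
  exact hunit hmap.symm

lemma exists_adjugate_ne_zero {M0 : Matrix (Fin 5) (Fin 5) ℤ} (hdet : M0.det ≠ 0) (i : Fin 5) :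
    ∃ j, M0.adjugate i j ≠ 0 := by
  by_contra! h
  have := congrFun (congrFun (Matrix.adjugate_mul M0) i) i
  rw [Matrix.mul_apply, Finset.sum_eq_zero fun k _ => by rw [h k, zero_mul]] at this
  exact hdet (by simpa using this.symm)

theorem statement17 (M0 : Matrix (Fin 5) (Fin 5) ℤ)
    (hrk : (M0.map (fun x : ℤ => (x : ℚ))).rank = 5) :
    ∃ C > 0, ∃ X0 : ℝ, ∀ X : ℝ, X0 ≤ X →
      ∀ Y : ℝ, 0 < Y → Y ≤ X → ∀ q : ℕ, 0 < q → ∀ c : Fin 5 → ℤ, ∀ H : Fin 5 → ℝ,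
      (∀ i, (q : ℝ) * Real.log X ≤ H i) →
      Hcal M0 Y q c H ≤
        C * (∏ i, H i) * ((q : ℝ) ^ 5)⁻¹ * (q.divisors.card : ℝ) := by
  have hdet := det_ne_zero_of_rank_eq_five hrk
  choose j hj using exists_adjugate_ne_zero hdet
  choose C hC hbound using fun i => sum_rhoZ_pow_five_le hdet (hj i)
  refine ⟨∑ i, C i, Finset.sum_pos (fun i _ => hC i) Finset.univ_nonempty, Real.exp 1, ?_⟩
  intro X hX Y _ hYX q hq c H hH
  have hlog : 1 ≤ Real.log X := (Real.le_log_iff_exp_le ((Real.exp_pos 1).trans_le hX)).2 hX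
  set S : Finset (Fin 5 → ℤ) := (Fintype.piFinset fun _ => Finset.Icc (-⌈Y⌉) ⌈Y⌉).filter
    fun v => ∀ j, v j ≠ 0 ∧ |(v j : ℝ)| < Y ∧ H j < |(hval M0 j v : ℝ)| ∧
      |(hval M0 j v : ℝ)| ≤ 2 * H j ∧ hval M0 j v ≡ c j [ZMOD (q : ℤ)] with hS
  have hsum : Hcal M0 Y q c H = ∑ v ∈ S, ∏ i, rhoZ (v i) := by
    rw [Hcal, hS, Finset.sum_filter]
    refine tsum_eq_sum fun v hv => if_neg fun hcond => hv ?_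
    rw [Fintype.mem_piFinset]
    intro k
    have hk := abs_lt.1 (hcond k).2.1
    have hceil := Int.le_ceil Y
    rw [Finset.mem_Icc]
    constructor
    · have : (-⌈Y⌉ : ℝ) ≤ v k := by linarith
      exact_mod_cast this
    · have : (v k : ℝ) ≤ ⌈Y⌉ := by linarith
      exact_mod_cast this
  have hmem : ∀ v ∈ S, ∀ k, v k ≠ 0 ∧ |(v k : ℝ)| < Y ∧ H k < |(hval M0 k v : ℝ)| ∧
      |(hval M0 k v : ℝ)| ≤ 2 * H k ∧ hval M0 k v ≡ c k [ZMOD (q : ℤ)] :=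
    fun v hv => (Finset.mem_filter.1 hv).2
  calc Hcal M0 Y q c H = ∑ v ∈ S, ∏ i, rhoZ (v i) := hsum
    _ ≤ ∑ v ∈ S, ∑ i, rhoZ (v i) ^ 5 :=
        Finset.sum_le_sum fun v _ => prod_fin_five_le_sum_pow _ fun i => rhoZ_nonneg _
    _ = ∑ i, ∑ v ∈ S, rhoZ (v i) ^ 5 := Finset.sum_comm
    _ ≤ ∑ i, C i * (∏ k, H k) * ((q : ℝ) ^ 5)⁻¹ * (q.divisors.card : ℝ) :=
        Finset.sum_le_sum fun i _ => hbound i X hlog q hq c H hH S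
          (fun v hv k => (hmem v hv k).2.2)
          (fun v hv => ⟨(hmem v hv i).1, (hmem v hv i).2.1.le.trans hYX⟩)
    _ = (∑ i, C i) * (∏ i, H i) * ((q : ℝ) ^ 5)⁻¹ * (q.divisors.card : ℝ) := by
        simp only [Finset.sum_mul]
end
end
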